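/- arXiv:2411.08270 — 5 statements merged into one kernel-verified Lean document; each statement's English description precedes it below -/
import Mathlib

section
/- Let d be an even integer with d ≥ 4, let q = p^a be a prime power, and let g ∈ GL_d(𝔽_q) have prime order r, where r is a primitive prime divisor of q^{d/2} − 1. Then exactly one of the following holds: (1) g is a (d/2)-stingray element, and its characteristic polynomial equals (X − 1)^{d/2}·f for a monic irreducible polynomial f of degree d/2 dividing X^r − 1; (2) the characteristic polynomial of g equals f₁·f₂ for two distinct monic irreducible polynomials f₁ ≠ f₂ of degree d/2 dividing X^r − 1, and in this case the minimal polynomial of g equals its characteristic polynomial; (3) the characteristic polynomial of g equals f² for a monic irreducible polynomial f of degree d/2 dividing X^r − 1. -/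
/-- A matrix `g ∈ GL_d(F)` (viewed here through the linear map `v ↦ g *ᵥ v` on `F^d`)
is an `e`-stingray element if `F^d = U ⊕ Fix(g)` where `Fix(g)` is the fixed-point
subspace of `g` and `U` is a `g`-invariant subspace of dimension `e` on which `g` acts
irreducibly (the only `g`-invariant subspaces of `U` are `0` and `U`). -/
def IsStingray {F : Type*} [Field F] {d : ℕ}
    (g : Matrix (Fin d) (Fin d) F) (e : ℕ) : Prop :=
  ∃ U : Submodule F (Fin d → F),
    Module.finrank F ↥U = e ∧
    Submodule.map g.mulVecLin U ≤ U ∧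
    IsCompl U (LinearMap.ker (g.mulVecLin - LinearMap.id)) ∧
    ∀ W : Submodule F (Fin d → F), W ≤ U → Submodule.map g.mulVecLin W ≤ W →
      W = ⊥ ∨ W = U

/-- Case (1): `g` is a `(d/2)`-stingray element and its characteristic polynomial is
`(X - 1)^{d/2} · f` for a monic irreducible `f` of degree `d/2` dividing `X^r - 1`. -/
def StingrayCase {F : Type*} [Field F] {d : ℕ} (r : ℕ)
    (M : Matrix (Fin d) (Fin d) F) : Prop :=
  IsStingray M (d / 2) ∧
    ∃ f : Polynomial F, f.Monic ∧ Irreducible f ∧ f.natDegree = d / 2 ∧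
      f ∣ Polynomial.X ^ r - 1 ∧
      M.charpoly = (Polynomial.X - 1) ^ (d / 2) * f

/-- Case (2): the characteristic polynomial of `g` is `f₁ · f₂` for two distinct monic
irreducible polynomials of degree `d/2` dividing `X^r - 1`; in this case the minimal
polynomial of `g` equals its characteristic polynomial. -/
def TwoFactorCase {F : Type*} [Field F] {d : ℕ} (r : ℕ)
    (M : Matrix (Fin d) (Fin d) F) : Prop :=
  ∃ f₁ f₂ : Polynomial F, f₁.Monic ∧ f₂.Monic ∧ Irreducible f₁ ∧ Irreducible f₂ ∧
    f₁.natDegree = d / 2 ∧ f₂.natDegree = d / 2 ∧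
    f₁ ∣ Polynomial.X ^ r - 1 ∧ f₂ ∣ Polynomial.X ^ r - 1 ∧ f₁ ≠ f₂ ∧
    M.charpoly = f₁ * f₂ ∧ minpoly F M = M.charpoly

/-- Case (3): the characteristic polynomial of `g` is `f²` for a monic irreducible
polynomial `f` of degree `d/2` dividing `X^r - 1`. -/
def SquareCase {F : Type*} [Field F] {d : ℕ} (r : ℕ)
    (M : Matrix (Fin d) (Fin d) F) : Prop :=
  ∃ f : Polynomial F, f.Monic ∧ Irreducible f ∧ f.natDegree = d / 2 ∧
    f ∣ Polynomial.X ^ r - 1 ∧ M.charpoly = f ^ 2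

section

open Polynomial

theorem Module.End.dvd_of_irreducible_dvd_charpoly {K V : Type*} [Field K] [AddCommGroup V]
    [Module K V] [FiniteDimensional K V] (T : Module.End K V) {f P : K[X]} (hf : Irreducible f)
    (hfT : f ∣ T.charpoly) (hP : aeval T P = 0) : f ∣ P := by
  have : Fact (Irreducible f) := ⟨hf⟩
  have hroot : (T.baseChange (AdjoinRoot f)).charpoly.IsRoot (AdjoinRoot.root f) := by
    rw [LinearMap.charpoly_baseChange, IsRoot.def, eval_map_algebraMap, AdjoinRoot.aeval_eq]
    exact AdjoinRoot.mk_eq_zero.mpr hfT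
  obtain ⟨v, hv⟩ :=
    ((Module.End.hasEigenvalue_iff_isRoot_charpoly _ _).mpr hroot).exists_hasEigenvector
  have hzero : aeval (T.baseChange (AdjoinRoot f)) (P.map (algebraMap K (AdjoinRoot f))) = 0 := by
    rw [aeval_map_algebraMap]
    have := aeval_algHom_apply (Module.End.baseChangeHom K (AdjoinRoot f) V) T P
    rw [hP, map_zero] at this
    exact this
  have h := Module.End.aeval_apply_of_hasEigenvector
    (p := P.map (algebraMap K (AdjoinRoot f))) hv
  rw [hzero, LinearMap.zero_apply, eval_map_algebraMap, AdjoinRoot.aeval_eq] at h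
  exact AdjoinRoot.mk_eq_zero.mp ((smul_eq_zero.mp h.symm).resolve_right hv.2)

theorem Polynomial.Monic.exists_eq_pow_of_irreducible_factors {K : Type*} [Field K] {Q h : K[X]}
    (hQ : Q.Monic) (hh : h.Monic)
    (hfac : ∀ f : K[X], f.Monic → Irreducible f → f ∣ Q → f = h) : ∃ n, Q = h ^ n := by
  induction hn : Q.natDegree using Nat.strong_induction_on generalizing Q with
  | _ n ih =>
    by_cases hu : IsUnit Q
    · exact ⟨0, by rw [pow_zero, hQ.eq_one_of_isUnit hu]⟩
    · obtain ⟨f, hfm, hf, hfQ⟩ := exists_monic_irreducible_factor Q hu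
      obtain rfl := hfac f hfm hf hfQ
      obtain ⟨R, rfl⟩ := hfQ
      have hR : R.Monic := hfm.of_mul_monic_left hQ
      obtain ⟨m, hm⟩ := ih R.natDegree (by
        have := hfm.natDegree_mul hR
        have := hf.natDegree_pos
        omega) hR (fun f' h1 h2 h3 => hfac f' h1 h2 (h3.mul_left f)) rfl
      exact ⟨m + 1, by rw [hm, pow_succ']⟩

theorem Module.End.natDegree_dvd_finrank_of_aeval_eq_zero {K V : Type*} [Field K] [AddCommGroup V]
    [Module K V] [FiniteDimensional K V] (T : Module.End K V) {f : K[X]} (hf : Irreducible f)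
    (hfm : f.Monic) (hT : aeval T f = 0) : f.natDegree ∣ Module.finrank K V := by
  obtain ⟨n, hn⟩ := T.charpoly_monic.exists_eq_pow_of_irreducible_factors hfm
    fun f' hm hi hd => eq_of_monic_of_associated hm hfm
      (hi.associated_of_dvd hf (T.dvd_of_irreducible_dvd_charpoly hi hd hT))
  rw [← T.charpoly_natDegree, hn, natDegree_pow]
  exact dvd_mul_left _ _

theorem Polynomial.coe_aeval_restrict_apply {K V : Type*} [Field K] [AddCommGroup V] [Module K V]
    (T : Module.End K V) {W : Submodule K V} (hW : ∀ x ∈ W, T x ∈ W) (P : K[X]) (x : W) :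
    (aeval (T.restrict hW) P x : V) = aeval T P x := by
  induction P using Polynomial.induction_on' with
  | add p q hp hq => simp [hp, hq]
  | monomial n a => simp [aeval_monomial, Module.End.pow_restrict n]

/-- The dimension of a `T`-invariant subspace annihilated by `f(T)`, with `f` irreducible, is a
multiple of the degree of `f`. -/
theorem Module.End.natDegree_dvd_finrank_of_le_ker_aeval {K V : Type*} [Field K] [AddCommGroup V]
    [Module K V] [FiniteDimensional K V] (T : Module.End K V) {f : K[X]} (hf : Irreducible f)
    (hfm : f.Monic) {W : Submodule K V} (hW : W.map T ≤ W)
    (hWf : W ≤ LinearMap.ker (aeval T f)) : f.natDegree ∣ Module.finrank K W := by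
  have hWT : ∀ x ∈ W, T x ∈ W := fun x hx => hW (Submodule.mem_map_of_mem hx)
  refine natDegree_dvd_finrank_of_aeval_eq_zero (T.restrict hWT) hf hfm ?_
  ext x
  rw [coe_aeval_restrict_apply]
  simpa using hWf x.2

theorem FiniteField.cast_ne_zero_of_dvd_card_pow_sub_one {F : Type*} [Field F] [Fintype F]
    {r e : ℕ} (he : 0 < e) (hdvd : r ∣ Fintype.card F ^ e - 1) : (r : F) ≠ 0 := by
  intro h0
  obtain ⟨k, hk⟩ := hdvd
  have h := congrArg (Nat.cast : ℕ → F) hk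
  rw [Nat.cast_sub (Nat.one_le_pow _ _ Fintype.card_pos)] at h
  simp [he.ne', h0] at h

/-- If `r` is a primitive prime divisor of `q ^ e - 1`, then over the field with `q` elements every
monic irreducible factor of `X ^ r - 1` other than `X - 1` has degree `e`. -/
theorem FiniteField.natDegree_of_irreducible_dvd_X_pow_sub_one {F : Type*} [Field F]
    [Fintype F] {r e : ℕ} (hr : r.Prime) (he : 0 < e)
    (hdvd : r ∣ Fintype.card F ^ e - 1)
    (hppd : ∀ i, 1 ≤ i → i < e → ¬ r ∣ Fintype.card F ^ i - 1)
    {f : F[X]} (hf : Irreducible f) (hfm : f.Monic) (hfr : f ∣ X ^ r - 1) :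
    f = X - 1 ∨ f.natDegree = e := by
  have := Fact.mk hr
  rw [← cyclotomic_prime_mul_X_sub_one F r] at hfr
  rcases hf.prime.dvd_or_dvd hfr with h | h
  · right
    obtain ⟨p, _⟩ := CharP.exists F
    obtain ⟨n, hp, hn⟩ := FiniteField.card F p
    have := Fact.mk hp
    have hq : 1 ≤ Fintype.card F := Fintype.card_pos
    have hpr : p.Coprime r := by
      rw [Nat.coprime_primes hp hr]
      rintro rfl
      exact FiniteField.cast_ne_zero_of_dvd_card_pow_sub_one he hdvd (CharP.cast_eq_zero F p)
    rw [natDegree_of_dvd_cyclotomic_of_irreducible hn hpr h hf]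
    have key : ∀ i, (ZMod.unitOfCoprime _ (hpr.pow_left (n : ℕ))) ^ i = 1 ↔
        r ∣ Fintype.card F ^ i - 1 := by
      intro i
      rw [Units.ext_iff, ← (ZMod.natCast_eq_zero_iff _ _),
        Nat.cast_sub (Nat.one_le_pow _ _ hq), sub_eq_zero]
      simp [hn]
    exact (orderOf_eq_iff he).mpr ⟨(key e).mpr hdvd,
      fun i hi h0 h1 => hppd i h0 hi ((key i).mp h1)⟩
  · left
    have hX : (X - 1 : F[X]) = X - C 1 := by simp
    rw [hX] at h ⊢
    exact eq_of_monic_of_associated hfm (monic_X_sub_C 1)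
      (hf.associated_of_dvd (irreducible_X_sub_C 1) h)

theorem LinearMap.aeval_eq_zero_of_charpoly_dvd_pow {K V : Type*} [Field K] [AddCommGroup V]
    [Module K V] [FiniteDimensional K V] (T : Module.End K V) {S s : K[X]} (hS : S.Separable)
    (hT : aeval T S = 0) (hs : s ∣ S) {n : ℕ} (hn : T.charpoly ∣ s ^ n) : aeval T s = 0 := by
  obtain ⟨h, rfl⟩ := hs
  have hcop : IsCoprime (minpoly K T) h :=
    (hS.isCoprime.pow_left (m := n)).of_isCoprime_of_dvd_left
      ((LinearMap.minpoly_dvd_charpoly T).trans hn)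
  exact (minpoly.dvd_iff).mp (hcop.dvd_of_dvd_mul_right (minpoly.dvd K T hT))

theorem Matrix.aeval_mulVecLin {F : Type*} [Field F] {n : Type*} [Fintype n] [DecidableEq n]
    (M : Matrix n n F) (P : F[X]) : aeval M.mulVecLin P = (aeval M P).mulVecLin :=
  aeval_algHom_apply (Matrix.toLinAlgEquiv' (R := F) (n := n)).toAlgHom M P

theorem Polynomial.natDegree_X_sub_one {F : Type*} [Field F] : (X - 1 : F[X]).natDegree = 1 := by
  simpa using natDegree_X_sub_C (1 : F)

theorem Polynomial.X_sub_one_ne_of_natDegree {F : Type*} [Field F] {f : F[X]}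
    (hf : 2 ≤ f.natDegree) : X - 1 ≠ f := by
  rintro rfl
  rw [natDegree_X_sub_one] at hf
  omega

theorem Polynomial.irreducible_X_sub_one {F : Type*} [Field F] : Irreducible (X - 1 : F[X]) := by
  simpa using irreducible_X_sub_C (1 : F)

theorem Polynomial.monic_X_sub_one {F : Type*} [Field F] : (X - 1 : F[X]).Monic := by
  simpa using monic_X_sub_C (1 : F)

theorem Polynomial.isCoprime_of_irreducible_of_monic_of_ne {F : Type*} [Field F] {f g : F[X]}
    (hf : Irreducible f) (hg : Irreducible g) (hfm : f.Monic) (hgm : g.Monic) (hne : f ≠ g) :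
    IsCoprime f g :=
  (EuclideanDomain.dvd_or_coprime f g hf).resolve_left fun h =>
    hne (eq_of_monic_of_associated hfm hgm (hf.associated_of_dvd hg h))

theorem isStingray_of_charpoly_eq {F : Type*} [Field F] {d r e : ℕ} {M : Matrix (Fin d) (Fin d) F}
    (he : 2 ≤ e) (hd : d = 2 * e) (hr : (r : F) ≠ 0) (hMr : M ^ r = 1) (hM1 : M ≠ 1) {f : F[X]}
    (hfm : f.Monic) (hf : Irreducible f) (hfe : f.natDegree = e) (hfr : f ∣ X ^ r - 1)
    (hM : M.charpoly = (X - 1) ^ e * f) : IsStingray M e := by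
  have hcop : IsCoprime f (X - 1 : F[X]) :=
    isCoprime_of_irreducible_of_monic_of_ne hf irreducible_X_sub_one hfm monic_X_sub_one
      (X_sub_one_ne_of_natDegree (hfe ▸ he)).symm
  have hann : aeval M.mulVecLin (f * (X - 1)) = 0 := by
    refine LinearMap.aeval_eq_zero_of_charpoly_dvd_pow (S := X ^ r - 1) (n := e) _
      (X_pow_sub_one_separable_iff.mpr hr) ?_ (hcop.mul_dvd hfr ?_) ?_
    · rw [Matrix.aeval_mulVecLin]
      simp [hMr]
    · simpa using sub_dvd_pow_sub_pow (X : F[X]) 1 r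
    · rw [Matrix.charpoly_mulVecLin, hM, mul_pow, mul_comm]
      exact mul_dvd_mul (dvd_pow_self f (by omega)) dvd_rfl
  have hX : aeval M.mulVecLin (X - 1 : F[X]) = M.mulVecLin - LinearMap.id := by
    simp [Module.End.one_eq_id]
  have hcompl : IsCompl (LinearMap.ker (aeval M.mulVecLin f))
      (LinearMap.ker (M.mulVecLin - LinearMap.id)) := by
    rw [← hX]
    refine ⟨disjoint_ker_aeval_of_isCoprime _ hcop, codisjoint_iff.mpr ?_⟩
    rw [sup_ker_aeval_eq_ker_aeval_mul_of_coprime _ hcop, hann, LinearMap.ker_zero]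
  have hinv : (LinearMap.ker (aeval M.mulVecLin f)).map M.mulVecLin ≤
      LinearMap.ker (aeval M.mulVecLin f) := by
    rintro _ ⟨x, hx, rfl⟩
    have hcomm : Commute (aeval M.mulVecLin f) M.mulVecLin := by
      simpa using Commute.map (Commute.all f X) (aeval M.mulVecLin)
    have h := LinearMap.congr_fun hcomm.eq x
    simp only [Module.End.mul_apply] at h
    rw [LinearMap.mem_ker, h, LinearMap.mem_ker.mp hx, map_zero]
  have hfix : LinearMap.ker (M.mulVecLin - LinearMap.id) ≠ ⊥ := by
    have hroot : M.mulVecLin.charpoly.IsRoot 1 := by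
      rw [Matrix.charpoly_mulVecLin, hM]
      simp [show e ≠ 0 by omega]
    have h := (Module.End.hasEigenvalue_iff_isRoot_charpoly _ _).mpr hroot
    rw [Module.End.hasEigenvalue_iff, Module.End.eigenspace_def] at h
    simpa [Module.End.one_eq_id] using h
  have hU : LinearMap.ker (aeval M.mulVecLin f) ≠ ⊥ := by
    intro h0
    rw [h0] at hcompl
    have h1 := LinearMap.ker_eq_top.mp (eq_top_of_bot_isCompl hcompl)
    refine hM1 (Matrix.toLin'.injective ?_)
    rw [Matrix.toLin'_one]
    exact sub_eq_zero.mp h1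
  have hrank : Module.finrank F (LinearMap.ker (aeval M.mulVecLin f)) = e := by
    have hsum := Submodule.finrank_add_eq_of_isCompl hcompl
    rw [Module.finrank_fin_fun] at hsum
    have h1 := Submodule.one_le_finrank_iff.mpr hU
    have h2 := Submodule.one_le_finrank_iff.mpr hfix
    obtain ⟨k, hk⟩ := Module.End.natDegree_dvd_finrank_of_le_ker_aeval _ hf hfm hinv le_rfl
    rw [hfe] at hk
    have hk0 : 0 < k := Nat.pos_of_ne_zero (by rintro rfl; omega)
    have hk2 : k < 2 := by
      by_contra! h
      nlinarith
    obtain rfl : k = 1 := by omega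
    simpa using hk
  refine ⟨LinearMap.ker (aeval M.mulVecLin f), hrank, hinv, hcompl, fun W hWU hW => ?_⟩
  rcases Nat.eq_zero_or_pos (Module.finrank F W) with h0 | hpos
  · exact Or.inl (Submodule.finrank_eq_zero.mp h0)
  · have hdvd := Module.End.natDegree_dvd_finrank_of_le_ker_aeval _ hf hfm hW hWU
    exact Or.inr (Submodule.eq_of_le_of_finrank_le hWU
      (by rw [hrank, ← hfe]; exact Nat.le_of_dvd hpos hdvd))

theorem StingrayCase.X_sub_one_dvd_charpoly {F : Type*} [Field F] {d r : ℕ}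
    {M : Matrix (Fin d) (Fin d) F} (hd : 2 ≤ d / 2) (h : StingrayCase r M) :
    (X - 1 : F[X]) ∣ M.charpoly := by
  obtain ⟨-, f, -, -, -, -, hM⟩ := h
  rw [hM]
  exact (dvd_pow_self _ (by omega)).mul_right _

theorem TwoFactorCase.not_stingrayCase {F : Type*} [Field F] {d r : ℕ}
    {M : Matrix (Fin d) (Fin d) F} (hd : 2 ≤ d / 2) (h : TwoFactorCase r M) :
    ¬ StingrayCase r M := by
  intro hS
  obtain ⟨f₁, f₂, hm₁, hm₂, hi₁, hi₂, he₁, he₂, -, -, -, hM, -⟩ := h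
  have hdvd := hS.X_sub_one_dvd_charpoly hd
  rw [hM] at hdvd
  rcases irreducible_X_sub_one.prime.dvd_or_dvd hdvd with h | h
  · exact X_sub_one_ne_of_natDegree (he₁ ▸ hd) (eq_of_monic_of_associated monic_X_sub_one hm₁
      (irreducible_X_sub_one.associated_of_dvd hi₁ h))
  · exact X_sub_one_ne_of_natDegree (he₂ ▸ hd) (eq_of_monic_of_associated monic_X_sub_one hm₂
      (irreducible_X_sub_one.associated_of_dvd hi₂ h))

theorem SquareCase.not_stingrayCase {F : Type*} [Field F] {d r : ℕ}
    {M : Matrix (Fin d) (Fin d) F} (hd : 2 ≤ d / 2) (h : SquareCase r M) :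
    ¬ StingrayCase r M := by
  intro hS
  obtain ⟨f, hm, hi, he, -, hM⟩ := h
  have hdvd := hS.X_sub_one_dvd_charpoly hd
  rw [hM] at hdvd
  exact X_sub_one_ne_of_natDegree (he ▸ hd) (eq_of_monic_of_associated monic_X_sub_one hm
    (irreducible_X_sub_one.associated_of_dvd hi (irreducible_X_sub_one.prime.dvd_of_dvd_pow hdvd)))

theorem SquareCase.not_twoFactorCase {F : Type*} [Field F] {d r : ℕ}
    {M : Matrix (Fin d) (Fin d) F} (h : SquareCase r M) : ¬ TwoFactorCase r M := by
  rintro ⟨f₁, f₂, hm₁, hm₂, hi₁, hi₂, -, -, -, -, hne, hM, -⟩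
  obtain ⟨f, hm, hi, -, -, hM'⟩ := h
  have key : ∀ g : F[X], g.Monic → Irreducible g → g ∣ f₁ * f₂ → g = f := fun g hgm hgi hg =>
    eq_of_monic_of_associated hgm hm (hgi.associated_of_dvd hi
      (hgi.prime.dvd_of_dvd_pow (hg.trans (by rw [← hM, hM']))))
  exact hne ((key f₁ hm₁ hi₁ (dvd_mul_right _ _)).trans (key f₂ hm₂ hi₂ (dvd_mul_left _ _)).symm)

theorem stingrayCase_or_twoFactorCase_or_squareCase {F : Type*} [Field F] [Fintype F] {d r : ℕ}
    {M : Matrix (Fin d) (Fin d) F} (hd4 : 4 ≤ d) (hd : Even d) (hr : r.Prime) (hMr : M ^ r = 1)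
    (hM1 : M ≠ 1) (hdvd : r ∣ Fintype.card F ^ (d / 2) - 1)
    (hppd : ∀ i, 1 ≤ i → i < d / 2 → ¬ r ∣ Fintype.card F ^ i - 1) :
    StingrayCase r M ∨ TwoFactorCase r M ∨ SquareCase r M := by
  obtain ⟨e, hde⟩ := hd
  have hd2 : d / 2 = e := by omega
  have he : 2 ≤ e := by omega
  unfold StingrayCase TwoFactorCase SquareCase
  rw [hd2] at hdvd hppd ⊢
  have hr0 : (r : F) ≠ 0 :=
    FiniteField.cast_ne_zero_of_dvd_card_pow_sub_one (by omega) hdvd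
  have hann : aeval M (X ^ r - 1 : F[X]) = 0 := by simp [hMr]
  have hdiv : ∀ {f P : F[X]}, Irreducible f → f ∣ M.charpoly → aeval M P = 0 → f ∣ P := by
    intro f P hf hfM hP
    refine Module.End.dvd_of_irreducible_dvd_charpoly M.mulVecLin hf (by simpa using hfM) ?_
    rw [Matrix.aeval_mulVecLin, hP, Matrix.mulVecLin_zero]
  have hfac : ∀ {f : F[X]}, f.Monic → Irreducible f → f ∣ M.charpoly →
      f = X - 1 ∨ f.natDegree = e := fun hfm hf hfM =>
    FiniteField.natDegree_of_irreducible_dvd_X_pow_sub_one hr (by omega) hdvd hppd hf hfm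
      (hdiv hf hfM hann)
  by_cases h₁ : ∃ f : F[X], f.Monic ∧ Irreducible f ∧ f ∣ M.charpoly ∧ f.natDegree = e
  · obtain ⟨f, hfm, hf, hfM, hfe⟩ := h₁
    have hfr := hdiv hf hfM hann
    obtain ⟨Q, hQ⟩ := id hfM
    have hQm : Q.Monic := hfm.of_mul_monic_left (hQ ▸ M.charpoly_monic)
    have hQe : Q.natDegree = e := by
      have h := M.charpoly_natDegree_eq_dim
      rw [hQ, hfm.natDegree_mul hQm, Fintype.card_fin] at h
      omega
    have hQM : Q ∣ M.charpoly := hQ ▸ dvd_mul_left Q f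
    by_cases h₂ : ∃ f' : F[X], f'.Monic ∧ Irreducible f' ∧ f' ∣ Q ∧ f'.natDegree = e
    · obtain ⟨f', hfm', hf', hfQ', hfe'⟩ := h₂
      obtain rfl : f' = Q := (eq_of_monic_of_dvd_of_natDegree_le hfm' hQm hfQ' (by omega)).symm
      have hfr' := hdiv hf' hQM hann
      right
      by_cases hne : f = f'
      · subst hne
        exact Or.inr ⟨f, hfm, hf, hfe, hfr, by rw [hQ, sq]⟩
      · refine Or.inl ⟨f, f', hfm, hfm', hf, hf', hfe, hfe', hfr, hfr', hne, hQ, ?_⟩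
        have hcop := isCoprime_of_irreducible_of_monic_of_ne hf hf' hfm hfm' hne
        have hmin : M.charpoly ∣ minpoly F M := by
          rw [hQ]
          exact hcop.mul_dvd (hdiv hf hfM (minpoly.aeval F M)) (hdiv hf' hQM (minpoly.aeval F M))
        exact eq_of_monic_of_associated (minpoly.monic (Matrix.isIntegral M)) M.charpoly_monic
          (associated_of_dvd_dvd (Matrix.minpoly_dvd_charpoly M) hmin)
    · obtain ⟨n, hn⟩ := hQm.exists_eq_pow_of_irreducible_factors monic_X_sub_one
        fun f' hm hi hQ' => (hfac hm hi (hQ'.trans hQM)).resolve_right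
          fun h => h₂ ⟨f', hm, hi, hQ', h⟩
      have hne : n = e := by
        rw [← hQe, hn, monic_X_sub_one.natDegree_pow, natDegree_X_sub_one, mul_one]
      rw [hn, hne, mul_comm] at hQ
      exact Or.inl ⟨isStingray_of_charpoly_eq he (by omega) hr0 hMr hM1 hfm hf hfe hfr hQ,
        f, hfm, hf, hfe, hfr, hQ⟩
  · exfalso
    obtain ⟨n, hn⟩ := M.charpoly_monic.exists_eq_pow_of_irreducible_factors monic_X_sub_one
      fun f hm hi hfM => (hfac hm hi hfM).resolve_right fun h => h₁ ⟨f, hm, hi, hfM, h⟩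
    have h1 : aeval M.mulVecLin (X - 1 : F[X]) = 0 := by
      refine LinearMap.aeval_eq_zero_of_charpoly_dvd_pow (S := X ^ r - 1) (n := n) _
        (X_pow_sub_one_separable_iff.mpr hr0) ?_ ?_ ?_
      · rw [Matrix.aeval_mulVecLin, hann, Matrix.mulVecLin_zero]
      · simpa using sub_dvd_pow_sub_pow (X : F[X]) 1 r
      · rw [Matrix.charpoly_mulVecLin, hn]
    refine hM1 (Matrix.toLin'.injective ?_)
    rw [Matrix.toLin'_one]
    have h2 : M.mulVecLin - LinearMap.id = 0 := by simpa [Module.End.one_eq_id] using h1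
    exact sub_eq_zero.mp h2

end

/-- Let `d ≥ 4` be even, `q = p^a` a prime power, and `g ∈ GL_d(𝔽_q)` of prime order `r`,
where `r` is a primitive prime divisor of `q^{d/2} - 1`.  Then exactly one of the three
cases (1), (2), (3) above holds for `g`. -/
theorem stmt5 (d p a q r : ℕ) (hd4 : 4 ≤ d) (hdeven : Even d)
    (hp : p.Prime) (ha : 0 < a) (hq : q = p ^ a)
    (F : Type*) [Field F] [Fintype F] (hF : Fintype.card F = q)
    (g : Matrix.GeneralLinearGroup (Fin d) F)
    (hr : r.Prime) (hord : orderOf g = r)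
    (hdvd : r ∣ q ^ (d / 2) - 1)
    (hppd : ∀ i, 1 ≤ i → i < d / 2 → ¬ r ∣ q ^ i - 1) :
    (StingrayCase r (g : Matrix (Fin d) (Fin d) F) ∧
      ¬ TwoFactorCase r (g : Matrix (Fin d) (Fin d) F) ∧
      ¬ SquareCase r (g : Matrix (Fin d) (Fin d) F)) ∨
    (¬ StingrayCase r (g : Matrix (Fin d) (Fin d) F) ∧
      TwoFactorCase r (g : Matrix (Fin d) (Fin d) F) ∧
      ¬ SquareCase r (g : Matrix (Fin d) (Fin d) F)) ∨
    (¬ StingrayCase r (g : Matrix (Fin d) (Fin d) F) ∧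
      ¬ TwoFactorCase r (g : Matrix (Fin d) (Fin d) F) ∧
      SquareCase r (g : Matrix (Fin d) (Fin d) F)) := by
  have hd : 2 ≤ d / 2 := by omega
  rw [← hF] at hdvd hppd
  have hMr : (g : Matrix (Fin d) (Fin d) F) ^ r = 1 := by
    rw [← Units.val_pow_eq_pow_val, ← hord, pow_orderOf_eq_one, Units.val_one]
  have hM1 : (g : Matrix (Fin d) (Fin d) F) ≠ 1 := by
    rw [Ne, Units.val_eq_one, ← orderOf_eq_one_iff, hord]
    exact hr.one_lt.ne'
  rcases stingrayCase_or_twoFactorCase_or_squareCase hd4 hdeven hr hMr hM1 hdvd hppd with h | h | h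
  · exact Or.inl ⟨h, fun h' => h'.not_stingrayCase hd h, fun h' => h'.not_stingrayCase hd h⟩
  · exact Or.inr (Or.inl ⟨h.not_stingrayCase hd, h, fun h' => h'.not_twoFactorCase h⟩)
  · exact Or.inr (Or.inr ⟨h.not_stingrayCase hd, h.not_twoFactorCase, h⟩)
end

section
/- For every integer n ≥ 5, every prime p, and every field F of characteristic p, the fully deleted permutation module V = W/(W ∩ D) over F is an irreducible F[A_n]-module for the alternating group A_n; in particular the S_n-module V is absolutely irreducible. -/
/-- The linear map `(x₁, …, xₙ) ↦ ∑ᵢ xᵢ` on `Fⁿ`. -/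
noncomputable def sumCoords (F : Type*) [Field F] (n : ℕ) : (Fin n → F) →ₗ[F] F :=
  ∑ i : Fin n, LinearMap.proj i

/-- `W = {x ∈ Fⁿ : ∑ᵢ xᵢ = 0}`. -/
noncomputable def Wsub (F : Type*) [Field F] (n : ℕ) : Submodule F (Fin n → F) :=
  LinearMap.ker (sumCoords F n)

/-- `D`, the span of the all-ones vector in `Fⁿ`. -/
noncomputable def Dsub (F : Type*) [Field F] (n : ℕ) : Submodule F (Fin n → F) :=
  Submodule.span F {fun _ => (1 : F)}

theorem mem_Wsub {F : Type*} [Field F] {n : ℕ} {x : Fin n → F} :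
    x ∈ Wsub F n ↔ ∑ i, x i = 0 := by
  simp [Wsub, sumCoords, LinearMap.sum_apply]

theorem mem_Dsub_of_forall_eq {F : Type*} [Field F] {n : ℕ} {x : Fin n → F} (a : Fin n)
    (h : ∀ b, x a = x b) : x ∈ Dsub F n :=
  Submodule.mem_span_singleton.2 ⟨x a, by ext b; simp [h b]⟩

/-- Outside any three points of a set with at least five elements there are two more. -/
theorem exists_ne_pair_of_five_le {n : ℕ} (hn : 5 ≤ n) (a b c : Fin n) :
    ∃ d e : Fin n, d ≠ a ∧ d ≠ b ∧ d ≠ c ∧ e ≠ a ∧ e ≠ b ∧ e ≠ c ∧ d ≠ e := by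
  have key (s : Finset (Fin n)) (hs : s.card ≤ 4) : ∃ d, d ∉ s := by
    by_contra! h
    have := Finset.card_le_card (fun i _ => h i : Finset.univ ⊆ s)
    rw [Finset.card_univ, Fintype.card_fin] at this
    omega
  obtain ⟨d, hd⟩ := key {a, b, c} (Finset.card_le_three.trans (by norm_num))
  obtain ⟨e, he⟩ := key {d, a, b, c} Finset.card_le_four
  simp only [Finset.mem_insert, Finset.mem_singleton, not_or] at hd he
  exact ⟨d, e, hd.1, hd.2.1, hd.2.2, he.2.1, he.2.2.1, he.2.2.2, Ne.symm he.1⟩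

/-- A subspace invariant under even permutations contains `e_b - e_c` as soon as it contains a
vector with different entries at `b, c` and equal entries at two further places. -/
theorem single_sub_single_mem {F ι : Type*} [Field F] [DecidableEq ι] [Fintype ι]
    {M : Submodule F (ι → F)}
    (hM : ∀ σ : Equiv.Perm ι, Equiv.Perm.sign σ = 1 → ∀ x ∈ M, x ∘ σ ∈ M)
    {x : ι → F} (hx : x ∈ M) {b c d e : ι} (hxbc : x b ≠ x c) (hxde : x d = x e)
    (hde : d ≠ e) (hdb : d ≠ b) (hdc : d ≠ c) (heb : e ≠ b) (hec : e ≠ c) :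
    (Pi.single b 1 - Pi.single c 1 : ι → F) ∈ M := by
  have hbc : b ≠ c := fun h => hxbc (by rw [h])
  have hσ : Equiv.Perm.sign (Equiv.swap b c * Equiv.swap d e) = 1 := by
    simp [Equiv.Perm.sign_swap hbc, Equiv.Perm.sign_swap hde]
  have hy := M.smul_mem (x b - x c)⁻¹ (M.sub_mem hx (hM _ hσ x hx))
  convert hy using 1
  have h0 : x b - x c ≠ 0 := sub_ne_zero.2 hxbc
  ext i
  simp only [Pi.sub_apply, Pi.smul_apply, Function.comp_apply, Equiv.Perm.mul_apply,
    Pi.single_apply, Equiv.swap_apply_def, smul_eq_mul]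
  field_simp
  grind

/-- A subspace of `W` which is invariant under even permutations and contains a nonconstant
vector is all of `W`. -/
theorem Wsub_le_of_nonconstant {F : Type*} [Field F] {n : ℕ} (hn : 5 ≤ n)
    {M : Submodule F (Fin n → F)}
    (hM : ∀ σ : Equiv.Perm (Fin n), Equiv.Perm.sign σ = 1 → ∀ x ∈ M, x ∘ σ ∈ M)
    {x : Fin n → F} (hx : x ∈ M) {a b : Fin n} (hab : x a ≠ x b) : Wsub F n ≤ M := by
  have hne : a ≠ b := fun h => hab (by rw [h])
  obtain ⟨c, -, hca, hcb, -⟩ := exists_ne_pair_of_five_le hn a b b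
  obtain ⟨d, e, hda, hdb, hdc, hea, heb, hec, hde⟩ := exists_ne_pair_of_five_le hn a b c
  have hσ : Equiv.Perm.sign (Equiv.swap a b * Equiv.swap b c) = 1 := by
    simp [Equiv.Perm.sign_swap hne, Equiv.Perm.sign_swap hcb.symm]
  obtain ⟨y, hy, hya, hyd, hye⟩ : ∃ y ∈ M, y a ≠ 0 ∧ y d = 0 ∧ y e = 0 := by
    refine ⟨_, M.sub_mem hx (hM _ hσ x hx), ?_, ?_, ?_⟩ <;>
    simp only [Pi.sub_apply, Function.comp_apply, Equiv.Perm.mul_apply,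
      Equiv.swap_apply_def] <;> grind
  obtain ⟨r, s, hrs, hmem⟩ : ∃ r s : Fin n, r ≠ s ∧
      (Pi.single r 1 - Pi.single s 1 : Fin n → F) ∈ M := by
    by_cases h₁ : y a = y b
    · by_cases h₂ : y b = y c
      · exact ⟨a, d, hda.symm, single_sub_single_mem hM hy (hyd ▸ hya) h₂ hcb.symm hne.symm
          hdb.symm hca hdc.symm⟩
      · exact ⟨b, c, hcb.symm, single_sub_single_mem hM hy h₂ (hyd.trans hye.symm) hde hdb hdc
          heb hec⟩
    · exact ⟨a, b, hne, single_sub_single_mem hM hy h₁ (hyd.trans hye.symm) hde hda hdb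
        hea heb⟩
  have hall (t : Fin n) : (Pi.single r 1 - Pi.single t 1 : Fin n → F) ∈ M := by
    by_cases hrt : r = t
    · simp [hrt]
    by_cases hst : s = t
    · rwa [← hst]
    obtain ⟨u, v, hur, hus, hut, hvr, hvs, hvt, huv⟩ := exists_ne_pair_of_five_le hn r s t
    refine single_sub_single_mem hM hmem (d := u) (e := v) ?_ ?_ huv hur hut hvr hvt <;>
    simp [*, Ne.symm hrt, Ne.symm hst]
  intro z hz
  have hz' : z = -∑ t, z t • (Pi.single r 1 - Pi.single t 1 : Fin n → F) := by
    ext i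
    simp [Finset.sum_apply, Pi.single_apply, mul_sub, Finset.sum_sub_distrib,
      mem_Wsub.1 hz]
  rw [hz']
  exact M.neg_mem (M.sum_mem fun t _ => M.smul_mem _ (hall t))

theorem eq_inf_or_eq_Wsub {F : Type*} [Field F] {n : ℕ} (hn : 5 ≤ n)
    {M : Submodule F (Fin n → F)} (hDM : Wsub F n ⊓ Dsub F n ≤ M) (hMW : M ≤ Wsub F n)
    (hM : ∀ σ : Equiv.Perm (Fin n), Equiv.Perm.sign σ = 1 →
      M.map (LinearMap.funLeft F F ⇑σ⁻¹) ≤ M) :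
    M = Wsub F n ⊓ Dsub F n ∨ M = Wsub F n := by
  have hM' (σ : Equiv.Perm (Fin n)) (hσ : Equiv.Perm.sign σ = 1) (x) (hx : x ∈ M) :
      x ∘ σ ∈ M := by
    have := hM σ⁻¹ (by simp [hσ]) (Submodule.mem_map_of_mem hx)
    rwa [inv_inv] at this
  by_cases h : ∃ x ∈ M, ∃ a b, x a ≠ x b
  · obtain ⟨x, hx, a, b, hab⟩ := h
    exact Or.inr (hMW.antisymm (Wsub_le_of_nonconstant hn hM' hx hab))
  · push Not at h
    exact Or.inl (le_antisymm
      (fun x hx => ⟨hMW hx, mem_Dsub_of_forall_eq ⟨0, by omega⟩ (h x hx _)⟩) hDM)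

/-- **Irreducibility of the fully deleted permutation module.**
For every `n ≥ 5`, every prime `p` and every field `F` of characteristic `p`, the fully
deleted permutation module `V = W/(W ∩ D)` is irreducible for `Aₙ`; in particular the
`Sₙ`-module `V` is (absolutely) irreducible.  Submodules of `V` correspond exactly to
submodules `M` of `Fⁿ` with `W ⊓ D ≤ M ≤ W`, so irreducibility of `V` is expressed as:
every such `M` invariant under the coordinate-permutation action of the relevant group
equals `W ⊓ D` or `W`.  (Here `σ` acts on `x : Fin n → F` by `x ∘ σ⁻¹`, and even
permutations are those with `sign σ = 1`.) -/
theorem stmt7 (n : ℕ) (hn : 5 ≤ n) (p : ℕ) (hp : p.Prime)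
    (F : Type*) [Field F] [CharP F p] :
    (∀ M : Submodule F (Fin n → F),
      Wsub F n ⊓ Dsub F n ≤ M → M ≤ Wsub F n →
      (∀ σ : Equiv.Perm (Fin n), Equiv.Perm.sign σ = 1 →
        M.map (LinearMap.funLeft F F ⇑σ⁻¹) ≤ M) →
      M = Wsub F n ⊓ Dsub F n ∨ M = Wsub F n) ∧
    (∀ M : Submodule F (Fin n → F),
      Wsub F n ⊓ Dsub F n ≤ M → M ≤ Wsub F n →
      (∀ σ : Equiv.Perm (Fin n),
        M.map (LinearMap.funLeft F F ⇑σ⁻¹) ≤ M) →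
      M = Wsub F n ⊓ Dsub F n ∨ M = Wsub F n) := by
  exact ⟨fun _ hDM hMW hM => eq_inf_or_eq_Wsub hn hDM hMW hM,
    fun _ hDM hMW hM => eq_inf_or_eq_Wsub hn hDM hMW fun σ _ => hM σ⟩
end

section
/- Let n ≥ 5, let p be a prime, q = p^a, and let V be the fully deleted permutation module for S_n over 𝔽_q. Let r be an odd prime with r ≤ n − 2 such that the multiplicative order of q modulo r equals r − 1 (equivalently, (X^r − 1)/(X − 1) is irreducible over 𝔽_q), and let g ∈ S_n be an r-cycle. Then the characteristic polynomial of g on V equals ((X^r − 1)/(X − 1))·(X − 1)^{d − r + 1}, where d = dim V = n − δ, and the action of g on V is an (r−1)-stingray element: its fixed-point subspace has dimension d − r + 1 and it acts irreducibly on a g-invariant complement of dimension r − 1. In particular, if r = d/2 + 1 then g acts on V as a (d/2)-stingray element. -/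
/-- `W ∩ D`, viewed as a submodule of `W`. -/
noncomputable def Nsub (F : Type*) [Field F] (n : ℕ) : Submodule F ↥(Wsub F n) :=
  (Wsub F n ⊓ Dsub F n).comap (Wsub F n).subtype

/-- The fully deleted permutation module `V = W/(W ∩ D)` over `F`. -/
abbrev DelMod (F : Type*) [Field F] (n : ℕ) := ↥(Wsub F n) ⧸ Nsub F n

/-- The action of a permutation `σ` on `W` (permuting coordinates, `x ↦ x ∘ σ⁻¹`). -/
noncomputable def permW (F : Type*) [Field F] (n : ℕ) (σ : Equiv.Perm (Fin n)) :
    ↥(Wsub F n) →ₗ[F] ↥(Wsub F n) :=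
  LinearMap.restrict (LinearMap.funLeft F F ⇑σ⁻¹)
    (p := Wsub F n) (q := Wsub F n) (by
      intro x hx
      simp only [Wsub, LinearMap.mem_ker, sumCoords, LinearMap.sum_apply,
        LinearMap.proj_apply, LinearMap.funLeft_apply] at hx ⊢
      simpa using (Equiv.sum_comp σ⁻¹ x).trans hx)

/-- The induced action of a permutation `σ` on the fully deleted permutation module. -/
noncomputable def permDel (F : Type*) [Field F] (n : ℕ) (σ : Equiv.Perm (Fin n)) :
    Module.End F (DelMod F n) :=
  Submodule.mapQ (Nsub F n) (Nsub F n) (permW F n σ) (by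
    intro x hx
    have hD : (x : Fin n → F) ∈ Dsub F n := hx.2
    refine Submodule.mem_comap.mpr (Submodule.mem_inf.mpr ⟨?_, ?_⟩)
    · exact (permW F n σ x).2
    · rw [Submodule.subtype_apply]
      have hcoe : (permW F n σ x : Fin n → F)
          = LinearMap.funLeft F F ⇑σ⁻¹ (x : Fin n → F) :=
        LinearMap.restrict_coe_apply _ _ _
      rw [hcoe]
      rw [Dsub, Submodule.mem_span_singleton] at hD ⊢
      obtain ⟨c, hc⟩ := hD
      refine ⟨c, ?_⟩
      funext i
      simpa using congrFun hc (σ⁻¹ i))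

/-- A linear endomorphism `g` of an `F`-vector space `M` is an `e`-stingray element if
`M = U ⊕ Fix(g)` where `Fix(g)` is the fixed-point subspace of `g` and `U` is a
`g`-invariant subspace of dimension `e` on which `g` acts irreducibly. -/
def IsStingrayOn (F : Type*) [Field F] {M : Type*} [AddCommGroup M] [Module F M]
    (g : Module.End F M) (e : ℕ) : Prop :=
  ∃ U : Submodule F M,
    Module.finrank F ↥U = e ∧
    Submodule.map g U ≤ U ∧
    IsCompl U (LinearMap.ker (g - LinearMap.id)) ∧
    ∀ W : Submodule F M, W ≤ U → Submodule.map g W ≤ W → W = ⊥ ∨ W = U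


open Polynomial in
/-- The characteristic polynomial is multiplicative over a direct sum of invariant subspaces. -/
theorem charpoly_eq_mul_of_isCompl {F M : Type*} [Field F] [AddCommGroup M] [Module F M]
    [FiniteDimensional F M] (f : Module.End F M) {U V : Submodule F M} (h : IsCompl U V)
    (hU : ∀ x ∈ U, f x ∈ U) (hV : ∀ x ∈ V, f x ∈ V) :
    f.charpoly = (f.restrict hU).charpoly * (f.restrict hV).charpoly := by
  have hconj : (f.restrict hU).prodMap (f.restrict hV) =
      (Submodule.prodEquivOfIsCompl U V h).symm.conj f := by
    refine LinearMap.ext fun x => ?_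
    rw [LinearEquiv.conj_apply_apply, LinearEquiv.eq_symm_apply]
    simp
  rw [← LinearMap.charpoly_prodMap, hconj, LinearEquiv.charpoly_conj]

open Polynomial in
/-- A monic irreducible polynomial annihilating an endomorphism of a nonzero space divides its
characteristic polynomial, so its degree is at most the dimension of the space. -/
theorem dvd_charpoly_and_natDegree_le_finrank {F M : Type*} [Field F] [AddCommGroup M]
    [Module F M] [FiniteDimensional F M] [Nontrivial M] (f : Module.End F M) {P : F[X]}
    (hP : Irreducible P) (hmonic : P.Monic) (h : aeval f P = 0) :
    P ∣ f.charpoly ∧ P.natDegree ≤ Module.finrank F M := by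
  have hmin : P = minpoly F f := minpoly.eq_of_irreducible_of_monic hP h hmonic
  have hdvd : P ∣ f.charpoly := hmin ▸ f.minpoly_dvd_charpoly
  exact ⟨hdvd, f.charpoly_natDegree ▸ natDegree_le_of_dvd hdvd f.charpoly_monic.ne_zero⟩

open Polynomial in
theorem aeval_restrict_eq_zero {F M : Type*} [Field F] [AddCommGroup M] [Module F M]
    (f : Module.End F M) {U : Submodule F M} (hU : ∀ x ∈ U, f x ∈ U) {P : F[X]}
    (hP : U ≤ LinearMap.ker (aeval f P)) :
    aeval (f.restrict hU : Module.End F U) P = 0 := by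
  refine LinearMap.ext fun x => Subtype.ext ?_
  have hcoe : ∀ Q : F[X], ((aeval (f.restrict hU : Module.End F U) Q x : U) : M) =
      aeval f Q (x : M) := by
    intro Q
    have hcomm : ∀ k : ℕ, (((f.restrict hU : Module.End F U) ^ k) x : M) = (f ^ k) (x : M) := by
      intro k
      rw [Module.End.pow_restrict]
      rfl
    simp [aeval_endomorphism, Polynomial.sum, hcomm]
  rw [hcoe]
  exact hP x.2

open Polynomial in
/-- An endomorphism killed by `P * (X - 1)`, with `P` irreducible and coprime to `X - 1`, and
whose displacement `f - 1` has nonzero rank at most `deg P`, is a stingray element. -/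
theorem isStingrayOn_of_aeval_eq_zero {F M : Type*} [Field F] [AddCommGroup M] [Module F M]
    [FiniteDimensional F M] (f : Module.End F M) {P : F[X]} (hP : Irreducible P)
    (hmonic : P.Monic) (hcop : IsCoprime P (X - 1)) (h : aeval f (P * (X - 1)) = 0)
    (hne : f - LinearMap.id ≠ 0)
    (hrank : Module.finrank F (LinearMap.range (f - LinearMap.id)) ≤ P.natDegree) :
    f.charpoly = P * (X - 1) ^ (Module.finrank F M - P.natDegree) ∧
      Module.finrank F (LinearMap.ker (f - LinearMap.id)) =
        Module.finrank F M - P.natDegree ∧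
      IsStingrayOn F f P.natDegree := by
  have haev : aeval f (X - 1 : F[X]) = f - LinearMap.id := by
    simp only [map_sub, aeval_X, map_one]; rfl
  set U := LinearMap.ker (aeval f P) with hUdef
  set K := LinearMap.ker (f - LinearMap.id) with hKdef
  have hcompl : IsCompl U K := by
    constructor
    · rw [hUdef, hKdef, ← haev]
      exact disjoint_ker_aeval_of_isCoprime f hcop
    · rw [codisjoint_iff, hUdef, hKdef, ← haev, sup_ker_aeval_eq_ker_aeval_mul_of_coprime f hcop, h,
        LinearMap.ker_zero]
  have hU : ∀ x ∈ U, f x ∈ U := by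
    intro x hx
    rw [hUdef, LinearMap.mem_ker] at hx ⊢
    have hcomm : aeval f P * f = f * aeval f P := by
      have := congrArg (aeval f) (mul_comm P X)
      simpa using this
    rw [← Module.End.mul_apply, hcomm, Module.End.mul_apply, hx, map_zero]
  have hfix : ∀ x ∈ K, f x = x := by
    intro x hx
    exact sub_eq_zero.mp hx
  have hK : ∀ x ∈ K, f x ∈ K := fun x hx => (hfix x hx).symm ▸ hx
  have hdim := Submodule.finrank_add_eq_of_isCompl hcompl
  have hrn := LinearMap.finrank_range_add_finrank_ker (f - LinearMap.id)
  have hmin : ∀ W : Submodule F M, W ≤ U → (∀ x ∈ W, f x ∈ W) → W ≠ ⊥ →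
      P.natDegree ≤ Module.finrank F W := by
    intro W hW hfW hbot
    have := Submodule.nontrivial_iff_ne_bot.mpr hbot
    exact (dvd_charpoly_and_natDegree_le_finrank (f.restrict hfW) hP hmonic
      (aeval_restrict_eq_zero f hfW hW)).2
  have hUbot : U ≠ ⊥ := by
    intro hbot
    have htop : K = ⊤ := by simpa [hbot] using hcompl.sup_eq_top
    exact hne (LinearMap.ker_eq_top.mp htop)
  have hUdim : Module.finrank F U = P.natDegree := by
    have := hmin U le_rfl hU hUbot
    rw [← hKdef] at hrn
    omega
  have hKdim : Module.finrank F K = Module.finrank F M - P.natDegree := by omega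
  refine ⟨?_, hKdim, U, hUdim, Submodule.map_le_iff_le_comap.mpr hU, hcompl, ?_⟩
  · rw [charpoly_eq_mul_of_isCompl f hcompl hU hK]
    have hUc : (f.restrict hU).charpoly = P := by
      have := Submodule.nontrivial_iff_ne_bot.mpr hUbot
      refine eq_of_monic_of_dvd_of_natDegree_le hmonic (LinearMap.charpoly_monic _)
        (dvd_charpoly_and_natDegree_le_finrank (f.restrict hU) hP hmonic
          (aeval_restrict_eq_zero f hU le_rfl)).1 ?_
      rw [LinearMap.charpoly_natDegree, hUdim]
    have hKc : (f.restrict hK).charpoly = (X - 1) ^ Module.finrank F K := by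
      have : f.restrict hK = 1 := LinearMap.ext fun x => Subtype.ext (hfix x x.2)
      rw [this, LinearMap.charpoly_one]
    rw [hUc, hKc, hKdim]
  · intro W hW hfW
    by_cases hbot : W = ⊥
    · exact Or.inl hbot
    · have := hmin W hW (Submodule.map_le_iff_le_comap.mp hfW) hbot
      exact Or.inr (Submodule.eq_of_le_of_finrank_le hW (by omega))

theorem mem_Nsub {F : Type*} [Field F] {n : ℕ} {x : Wsub F n} :
    x ∈ Nsub F n ↔ ∃ c : F, ∀ i, (x : Fin n → F) i = c := by
  simp only [Nsub, Dsub, Submodule.mem_comap, Submodule.mem_inf, Submodule.subtype_apply,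
    SetLike.coe_mem, true_and, Submodule.mem_span_singleton]
  refine exists_congr fun c => ?_
  simp [funext_iff, eq_comm]

theorem finrank_Wsub (F : Type*) [Field F] {n : ℕ} (hn : 0 < n) :
    Module.finrank F (Wsub F n) = n - 1 := by
  have hsurj : Function.Surjective (sumCoords F n) := by
    intro c
    exact ⟨Pi.single ⟨0, hn⟩ c, by simp [sumCoords]⟩
  have := LinearMap.finrank_range_add_finrank_ker (sumCoords F n)
  rw [LinearMap.range_eq_top.mpr hsurj] at this
  simp only [finrank_top, Module.finrank_self, Module.finrank_fintype_fun_eq_card,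
    Fintype.card_fin] at this
  rw [Wsub]
  omega

theorem finrank_Nsub (F : Type*) [Field F] (p : ℕ) [CharP F p] {n : ℕ} (hn : 0 < n) :
    Module.finrank F (Nsub F n) = if p ∣ n then 1 else 0 := by
  have hequiv : Module.finrank F (Nsub F n) = Module.finrank F ↥(Wsub F n ⊓ Dsub F n) :=
    (Submodule.comapSubtypeEquivOfLe inf_le_left).finrank_eq
  have hmem : (fun _ => 1 : Fin n → F) ∈ Wsub F n ↔ p ∣ n := by
    simp [mem_Wsub, CharP.cast_eq_zero_iff F p]
  have hone : (fun _ => 1 : Fin n → F) ≠ 0 := fun h => one_ne_zero (congrFun h ⟨0, hn⟩)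
  rw [hequiv]
  split_ifs with hpn
  · rw [inf_eq_right.mpr, Dsub, finrank_span_singleton hone]
    rw [Dsub, Submodule.span_singleton_le_iff_mem]
    exact hmem.mpr hpn
  · rw [Submodule.finrank_eq_zero, ← disjoint_iff, Dsub,
      Submodule.disjoint_span_singleton' hone]
    exact fun h => hpn (hmem.mp h)

theorem finrank_DelMod (F : Type*) [Field F] (p : ℕ) [CharP F p] {n : ℕ} (hn : 0 < n) :
    Module.finrank F (DelMod F n) = n - if p ∣ n then 2 else 1 := by
  have h : Module.finrank F (DelMod F n) + Module.finrank F (Nsub F n) = _ :=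
    Submodule.finrank_quotient_add_finrank (Nsub F n)
  rw [finrank_Wsub F hn, finrank_Nsub F p hn] at h
  split_ifs at h ⊢ <;> omega

theorem permW_apply {F : Type*} [Field F] {n : ℕ} (σ : Equiv.Perm (Fin n)) (x : Wsub F n)
    (i : Fin n) : (permW F n σ x : Fin n → F) i = (x : Fin n → F) (σ⁻¹ i) := rfl

theorem permDel_mk {F : Type*} [Field F] {n : ℕ} (σ : Equiv.Perm (Fin n)) (x : Wsub F n) :
    permDel F n σ ((Nsub F n).mkQ x) = (Nsub F n).mkQ (permW F n σ x) := rfl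

theorem permDel_pow_mk {F : Type*} [Field F] {n : ℕ} (σ : Equiv.Perm (Fin n)) (k : ℕ)
    (x : Wsub F n) :
    (permDel F n σ ^ k) ((Nsub F n).mkQ x) = (Nsub F n).mkQ (permW F n (σ ^ k) x) := by
  induction k with
  | zero => rfl
  | succ k ih =>
    rw [pow_succ', Module.End.mul_apply, ih, permDel_mk]
    refine congrArg _ (Subtype.ext (funext fun i => ?_))
    simp [permW_apply, pow_succ', mul_inv_rev]

theorem permDel_pow_eq_one {F : Type*} [Field F] {n : ℕ} {σ : Equiv.Perm (Fin n)} {k : ℕ}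
    (h : σ ^ k = 1) : permDel F n σ ^ k = 1 := by
  refine LinearMap.ext fun y => ?_
  obtain ⟨x, rfl⟩ := (Nsub F n).mkQ_surjective y
  rw [permDel_pow_mk, h]
  rfl

/-- The difference `eⱼ - eᵢ` of two standard basis vectors, as an element of `W`. -/
noncomputable def diffW (F : Type*) [Field F] {n : ℕ} (i j : Fin n) : Wsub F n :=
  ⟨Pi.single j 1 - Pi.single i 1, by simp [mem_Wsub]⟩

theorem finrank_range_permDel_sub_id_le (F : Type*) [Field F] {n : ℕ} {σ : Equiv.Perm (Fin n)}
    {i₀ : Fin n} (hi₀ : i₀ ∈ σ.support) :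
    Module.finrank F (LinearMap.range (permDel F n σ - LinearMap.id)) ≤ σ.support.card - 1 := by
  classical
  set S := (σ.support.erase i₀).image fun j => (Nsub F n).mkQ (diffW F i₀ j) with hS
  have hle : LinearMap.range (permDel F n σ - LinearMap.id) ≤
      Submodule.span F (S : Set (DelMod F n)) := by
    rintro _ ⟨y, rfl⟩
    obtain ⟨x, rfl⟩ := (Nsub F n).mkQ_surjective y
    rw [LinearMap.sub_apply, LinearMap.id_apply, permDel_mk, ← map_sub]
    set z := permW F n σ x - x with hz
    have hzero : ∀ j, j ∉ σ.support → (z : Fin n → F) j = 0 := by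
      intro j hj
      have hj' : σ⁻¹ j = j := by
        rw [Equiv.Perm.inv_eq_iff_eq]
        exact (Equiv.Perm.notMem_support.mp hj).symm
      simp [hz, permW_apply, hj']
    have hsum : ∑ j ∈ σ.support, (z : Fin n → F) j = 0 := by
      rw [Finset.sum_subset (Finset.subset_univ _) fun j _ hj => hzero j hj]
      exact mem_Wsub.mp z.2
    have hdecomp : z = ∑ j ∈ σ.support.erase i₀, (z : Fin n → F) j • diffW F i₀ j := by
      refine Subtype.ext (funext fun k => ?_)
      rw [← Finset.add_sum_erase _ _ hi₀] at hsum
      have hz0 := eq_neg_of_add_eq_zero_left hsum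
      simp only [AddSubmonoidClass.coe_finsetSum, Submodule.coe_smul, diffW, Finset.sum_apply,
        Pi.smul_apply, Pi.sub_apply, smul_eq_mul, mul_sub, Finset.sum_sub_distrib]
      rw [← Finset.sum_mul]
      have hsingle : ∑ j ∈ σ.support.erase i₀, (z : Fin n → F) j * (Pi.single j 1 : Fin n → F) k =
          if k ∈ σ.support.erase i₀ then (z : Fin n → F) k else 0 := by
        simp only [Pi.single_apply, mul_ite, mul_one, mul_zero, Finset.sum_ite_eq]
      rw [hsingle]
      by_cases hk : k = i₀
      · subst hk
        rw [if_neg (Finset.notMem_erase k _), Pi.single_eq_same, hz0]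
        ring
      · rw [Pi.single_eq_of_ne hk, mul_zero, sub_zero]
        split_ifs with hmem
        · rfl
        · exact hzero k fun h => hmem (Finset.mem_erase.mpr ⟨hk, h⟩)
    rw [hdecomp, map_sum]
    refine Submodule.sum_mem _ fun j hj => ?_
    rw [map_smul]
    exact Submodule.smul_mem _ _ (Submodule.subset_span (Finset.mem_image_of_mem _ hj))
  calc Module.finrank F (LinearMap.range (permDel F n σ - LinearMap.id))
      ≤ Module.finrank F (Submodule.span F (S : Set (DelMod F n))) := Submodule.finrank_mono hle
    _ ≤ S.card := finrank_span_finset_le_card S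
    _ ≤ (σ.support.erase i₀).card := Finset.card_image_le
    _ = σ.support.card - 1 := Finset.card_erase_of_mem hi₀

theorem permDel_sub_id_ne_zero (F : Type*) [Field F] {n : ℕ} (hn : 3 ≤ n)
    {σ : Equiv.Perm (Fin n)} {i k : Fin n} (hi : σ i ≠ i) (hk : σ k = k) :
    permDel F n σ - LinearMap.id ≠ 0 := by
  intro h
  have hx := LinearMap.congr_fun h ((Nsub F n).mkQ (diffW F k i))
  rw [LinearMap.sub_apply, LinearMap.id_apply, permDel_mk, ← map_sub, LinearMap.zero_apply,
    Submodule.mkQ_apply, Submodule.Quotient.mk_eq_zero, mem_Nsub] at hx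
  obtain ⟨c, hc⟩ := hx
  have hval : ∀ j, (Pi.single (σ i) 1 - Pi.single i 1 : Fin n → F) j = c := by
    intro j
    rw [← hc j]
    have h1 : σ⁻¹ j = i ↔ j = σ i := Equiv.Perm.inv_eq_iff_eq
    have h2 : σ⁻¹ j = k ↔ j = k := by rw [Equiv.Perm.inv_eq_iff_eq, hk]
    simp only [AddSubgroupClass.coe_sub, Pi.sub_apply, permW_apply, diffW, Pi.single_apply, h1, h2]
    ring
  obtain ⟨l, hl⟩ : ∃ l, l ∉ ({i, σ i} : Finset (Fin n)) := by
    refine Finset.exists_mem_notMem_of_card_lt_card (s := {i, σ i}) (t := Finset.univ) ?_ |>.imp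
      fun _ h => h.2
    rw [Finset.card_univ, Fintype.card_fin]
    exact lt_of_le_of_lt Finset.card_le_two hn
  simp only [Finset.mem_insert, Finset.mem_singleton, not_or] at hl
  have hc0 := hval l
  have hc1 := hval (σ i)
  simp [hl.1, hl.2] at hc0
  simp [hi, ← hc0] at hc1

open Polynomial in
theorem irreducible_cyclotomic_of_orderOf_card {F : Type*} [Field F] [Fintype F] {r : ℕ}
    (hr : r.Prime) (horder : orderOf (Fintype.card F : ZMod r) = r - 1) :
    (r : F) ≠ 0 ∧ Irreducible (cyclotomic r F) := by
  have := Fact.mk hr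
  obtain ⟨p, hchar⟩ := CharP.exists F
  have hp : p.Prime := CharP.char_is_prime F p
  have := Fact.mk hp
  obtain ⟨a, -, ha⟩ := FiniteField.card F p
  have hpr : p ≠ r := by
    rintro rfl
    have h1 := hr.two_le
    rw [ha, Nat.cast_pow, CharP.cast_eq_zero, zero_pow a.ne_zero, orderOf_zero] at horder
    omega
  have hcop : p.Coprime r := (Nat.coprime_primes hp hr).mpr hpr
  refine ⟨fun h => hpr ((Nat.prime_dvd_prime_iff_eq hp hr).mp
    ((CharP.cast_eq_zero_iff F p r).mp h)), ?_⟩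
  refine irreducible_of_dvd_cyclotomic_of_natDegree ha hcop dvd_rfl ?_
  rw [natDegree_cyclotomic, Nat.totient_prime hr, ← horder, ← orderOf_units,
    ZMod.coe_unitOfCoprime, ha]

open Polynomial in
theorem isCoprime_cyclotomic_prime_X_sub_one {F : Type*} [Field F] {r : ℕ} (hr : r.Prime)
    (h0 : (r : F) ≠ 0) : IsCoprime (cyclotomic r F) (X - 1) := by
  have := Fact.mk hr
  have hirr : Irreducible (X - C (1 : F)) := irreducible_X_sub_C 1
  rw [C_1] at hirr
  refine (hirr.coprime_iff_not_dvd.mpr fun h => h0 ?_).symm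
  rw [← C_1, dvd_iff_isRoot, IsRoot.def, eval_one_cyclotomic_prime] at h
  exact h

/-- Let `n ≥ 5`, `q = p^a`, `δ = 1` if `p ∤ n` else `δ = 2`, `d = n - δ`.  Let `r ≤ n - 2`
be an odd prime such that the multiplicative order of `q` mod `r` is `r - 1`
(equivalently, `(X^r - 1)/(X - 1)` is irreducible over `𝔽_q`), and let `g ∈ Sₙ` be an
`r`-cycle.  Then the characteristic polynomial of `g` on the fully deleted permutation
module `V` is `((X^r - 1)/(X - 1))·(X - 1)^{d - r + 1}`, the fixed-point subspace of `g`
on `V` has dimension `d - r + 1`, and `g` acts on `V` as an `(r - 1)`-stingray element.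
In particular, if `r = d/2 + 1` then `g` acts on `V` as a `(d/2)`-stingray element. -/
theorem stmt9 (n p a q : ℕ) (hn : 5 ≤ n) (hp : p.Prime) (ha : 0 < a) (hq : q = p ^ a)
    (F : Type*) [Field F] [Fintype F] (hF : Fintype.card F = q)
    (δ d : ℕ) (hδ : δ = if p ∣ n then 2 else 1) (hd : d = n - δ)
    (r : ℕ) (hr : r.Prime) (hrodd : Odd r) (hrn : r ≤ n - 2)
    (horder : orderOf (q : ZMod r) = r - 1)
    (g : Equiv.Perm (Fin n)) (hg : g.IsCycle) (hsupp : g.support.card = r) :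
    LinearMap.charpoly (permDel F n g) =
      (∑ i ∈ Finset.range r, Polynomial.X ^ i) * (Polynomial.X - 1) ^ (d - r + 1) ∧
    Module.finrank F ↥(LinearMap.ker (permDel F n g - LinearMap.id)) = d - r + 1 ∧
    IsStingrayOn F (permDel F n g) (r - 1) ∧
    (r = d / 2 + 1 → IsStingrayOn F (permDel F n g) (d / 2)) := by
  have := Fact.mk hr
  have := Fact.mk hp
  have hchar : CharP F p := charP_of_card_eq_prime_pow (hF.trans hq)
  obtain ⟨hr0, hirr⟩ := irreducible_cyclotomic_of_orderOf_card (F := F) hr (hF ▸ horder)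
  have hr2 := hr.two_le
  have hdeg : (Polynomial.cyclotomic r F).natDegree = r - 1 := by
    rw [Polynomial.natDegree_cyclotomic, Nat.totient_prime hr]
  have hdim : Module.finrank F (DelMod F n) = d := by
    rw [finrank_DelMod F p (by omega), hd, hδ]
  have hrd : r ≤ d := by
    rw [hd, hδ]
    split_ifs <;> omega
  have hpow : permDel F n g ^ r = 1 :=
    permDel_pow_eq_one (by rw [← hsupp, ← hg.orderOf, pow_orderOf_eq_one])
  have haev : Polynomial.aeval (permDel F n g)
      (Polynomial.cyclotomic r F * (Polynomial.X - 1)) = 0 := by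
    simp [Polynomial.cyclotomic_prime_mul_X_sub_one, hpow]
  obtain ⟨i, hi⟩ := hg.nonempty_support
  obtain ⟨k, -, hk⟩ := Finset.exists_mem_notMem_of_card_lt_card
    (s := g.support) (t := Finset.univ) (by rw [Finset.card_univ, Fintype.card_fin]; omega)
  obtain ⟨hchp, hker, hsting⟩ := isStingrayOn_of_aeval_eq_zero (permDel F n g) hirr
    (Polynomial.cyclotomic.monic r F) (isCoprime_cyclotomic_prime_X_sub_one hr hr0) haev
    (permDel_sub_id_ne_zero F (by omega) (Equiv.Perm.mem_support.mp hi)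
      (Equiv.Perm.notMem_support.mp hk))
    (by rw [hdeg, ← hsupp]; exact finrank_range_permDel_sub_id_le F hi)
  have hexp : d - (r - 1) = d - r + 1 := by omega
  rw [hdim, hdeg, hexp] at hchp hker
  rw [hdeg] at hsting
  refine ⟨by rw [hchp, Polynomial.cyclotomic_prime], hker, hsting, fun h => ?_⟩
  rwa [show d / 2 = r - 1 by omega]
end

section
/- Neither PSL₂(𝔽₂₅) (the quotient of SL₂(𝔽₂₅) by its center {±I}) nor PSL₃(𝔽₃) (which equals SL₃(𝔽₃), since SL₃(𝔽₃) has trivial center) contains an element of order 9. -/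
open scoped MatrixGroups

instance : Fact (Nat.Prime 5) := ⟨by norm_num⟩

namespace Matrix

variable {n R : Type*} [Fintype n] [DecidableEq n] [CommRing R]

lemma SpecialLinearGroup.natCard_mul_natCard_units [Nonempty n] :
    Nat.card (SpecialLinearGroup n R) * Nat.card Rˣ = Nat.card (GL n R) := by
  let det : GL n R →* Rˣ := GeneralLinearGroup.det
  have hker : (SpecialLinearGroup.toGL : SpecialLinearGroup n R →* GL n R).range = det.ker := by
    ext A
    refine ⟨?_, fun hA ↦ ⟨⟨A, congrArg Units.val (MonoidHom.mem_ker.1 hA)⟩, Units.ext rfl⟩⟩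
    rintro ⟨A, rfl⟩
    exact MonoidHom.mem_ker.2 (Units.ext A.2)
  have hcard : Nat.card (SpecialLinearGroup n R) = Nat.card det.ker := by
    rw [← hker]
    exact Nat.card_congr (MonoidHom.ofInjective SpecialLinearGroup.toGL_injective).toEquiv
  rw [hcard, ← det.ker.card_mul_index, Subgroup.index_ker,
    MonoidHom.range_eq_top.2 GeneralLinearGroup.det_surjective, Subgroup.card_top]

lemma pow_card_eq_zero_of_isNilpotent [IsDomain R] {M : Matrix n n R} (hM : IsNilpotent M) :
    M ^ Fintype.card n = 0 := by
  have h := M.aeval_self_charpoly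
  rwa [sub_eq_zero.1 (isNilpotent_charpoly_sub_pow_of_isNilpotent hM).eq_zero, map_pow,
    Polynomial.aeval_X] at h

/-- In characteristic `p`, a `p`-element of `SL n R` has exponent dividing `p ^ k` as soon as
`n ≤ p ^ k`. -/
lemma SpecialLinearGroup.pow_char_pow_eq_one [Nonempty n] [IsDomain R] (p : ℕ) [Fact p.Prime]
    [CharP R p] {k m : ℕ} (hk : Fintype.card n ≤ p ^ k) {A : SpecialLinearGroup n R}
    (hA : A ^ p ^ m = 1) : A ^ p ^ k = 1 := by
  have hsub (j : ℕ) : (A.1 - 1) ^ p ^ j = A.1 ^ p ^ j - 1 := by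
    simpa using sub_pow_char_pow_of_commute (p := p) (n := j) (Commute.one_right A.1)
  have hnil : IsNilpotent (A.1 - 1) :=
    ⟨p ^ m, by rw [hsub, sub_eq_zero]; simpa using congrArg Subtype.val hA⟩
  apply Subtype.ext
  have h := pow_eq_zero_of_le hk (pow_card_eq_zero_of_isNilpotent hnil)
  rw [hsub, sub_eq_zero] at h
  simpa using h

end Matrix

lemma natCard_specialLinearGroup_two_galoisField_five_two :
    Nat.card SL(2, GaloisField 5 2) = 15600 := by
  have : Fintype (GaloisField 5 2) := Fintype.ofFinite _
  have hcard : Nat.card (GaloisField 5 2) = 25 := GaloisField.card 5 2 (by norm_num)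
  have h := Matrix.SpecialLinearGroup.natCard_mul_natCard_units (n := Fin 2)
    (R := GaloisField 5 2)
  rw [Matrix.card_GL_field, Nat.card_units, ← Nat.card_eq_fintype_card, hcard] at h
  simp [Fin.prod_univ_two] at h
  omega

/-- Neither `PSL₂(𝔽₂₅)` (the quotient of `SL₂(𝔽₂₅)` by its center) nor `PSL₃(𝔽₃)`
contains an element of order `9`. -/
theorem stmt15 :
    (¬ ∃ g : PSL(2, GaloisField 5 2), orderOf g = 9) ∧
    (¬ ∃ g : PSL(3, ZMod 3), orderOf g = 9) := by
  refine ⟨fun ⟨g, hg⟩ ↦ ?_, fun ⟨g, hg⟩ ↦ ?_⟩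
  · have h := (orderOf_dvd_natCard g).trans (Subgroup.card_quotient_dvd_card _)
    rw [hg, natCard_specialLinearGroup_two_galoisField_five_two] at h
    norm_num at h
  · obtain ⟨A, rfl⟩ := QuotientGroup.mk_surjective g
    have hcenter : A ^ 9 ∈ Subgroup.center SL(3, ZMod 3) := by
      rw [← QuotientGroup.eq_one_iff, QuotientGroup.mk_pow, ← hg, pow_orderOf_eq_one]
    have hA : A ^ 3 ^ 3 = 1 := by
      obtain ⟨r, hr, h⟩ := Matrix.SpecialLinearGroup.mem_center_iff.1 hcenter
      apply Subtype.ext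
      rw [show 3 ^ 3 = 9 * 3 by norm_num, pow_mul, Matrix.SpecialLinearGroup.coe_pow, ← h,
        ← map_pow, show r ^ 3 = 1 by simpa using hr, map_one, Matrix.SpecialLinearGroup.coe_one]
    have hA3 : A ^ 3 ^ 1 = 1 :=
      Matrix.SpecialLinearGroup.pow_char_pow_eq_one 3 (by simp) hA
    have h : orderOf (A : PSL(3, ZMod 3)) ∣ 3 := by
      rw [orderOf_dvd_iff_pow_eq_one, ← QuotientGroup.mk_pow, show A ^ 3 = 1 from hA3,
        QuotientGroup.mk_one]
    rw [hg] at h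
    norm_num at h
end

section
/- Let q = p^a with p a prime, p ≥ 5 and q ≥ 7. Let P be the 4-dimensional 𝔽_q-vector space of homogeneous polynomials of degree 3 in two variables, with SL₂(𝔽_q) acting by linear substitution of variables: (g·f)(v) = f(g⁻¹ v). (a) If q ≡ 2 (mod 3), then for every h ∈ SL₂(𝔽_q) of order 3 the induced linear map on P is a 2-stingray element (and 3 is then a primitive prime divisor of q² − 1). (b) Conversely, if some h ∈ SL₂(𝔽_q) induces on P a 2-stingray element of prime order r, where r is a primitive prime divisor of q² − 1, then q ≡ 2 (mod 3) and r = 3. -/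
/-- Substitution of variables by a matrix `m`: the algebra endomorphism of
`F[X₀, X₁]` sending `Xᵢ ↦ ∑ⱼ mᵢⱼ Xⱼ`; on a polynomial `f` it produces `v ↦ f (m v)`. -/
noncomputable def substMap (F : Type*) [Field F] (m : Matrix (Fin 2) (Fin 2) F) :
    MvPolynomial (Fin 2) F →ₐ[F] MvPolynomial (Fin 2) F :=
  MvPolynomial.aeval (fun i => ∑ j, m i j • MvPolynomial.X j)

set_option maxHeartbeats 1000000 in
/-- The action of `g ∈ SL₂(𝔽_q)` on the `4`-dimensional space `P` of homogeneous cubic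
polynomials in two variables, by linear substitution of variables:
`(g · f)(v) = f (g⁻¹ v)`. -/
noncomputable def cubicAction (F : Type*) [Field F]
    (g : Matrix.SpecialLinearGroup (Fin 2) F) :
    Module.End F ↥(MvPolynomial.homogeneousSubmodule (Fin 2) F 3) :=
  LinearMap.restrict (substMap F ((g⁻¹ : Matrix.SpecialLinearGroup (Fin 2) F) :
      Matrix (Fin 2) (Fin 2) F)).toLinearMap
    (p := MvPolynomial.homogeneousSubmodule (Fin 2) F 3)
    (q := MvPolynomial.homogeneousSubmodule (Fin 2) F 3) (by
      intro f hf
      rw [MvPolynomial.mem_homogeneousSubmodule] at hf ⊢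
      have : (MvPolynomial.aeval (fun i => ∑ j,
          ((g⁻¹ : Matrix.SpecialLinearGroup (Fin 2) F) : Matrix (Fin 2) (Fin 2) F) i j •
            (MvPolynomial.X j : MvPolynomial (Fin 2) F)) f).IsHomogeneous (1 * 3) :=
        hf.aeval _ (fun i => by
          apply MvPolynomial.IsHomogeneous.sum
          intro j _
          rw [MvPolynomial.smul_eq_C_mul]
          exact (MvPolynomial.isHomogeneous_X F j).C_mul _)
      rw [one_mul] at this
      exact this)

open MvPolynomial in
/-- The binary cubic form with coefficients `x` in the monomials `X³, X²Y, XY², Y³`. -/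
noncomputable def cubicForm (F : Type*) [Field F] :
    (Fin 4 → F) →ₗ[F] homogeneousSubmodule (Fin 2) F 3 where
  toFun x := ⟨C (x 0) * X 0 ^ 3 + C (x 1) * (X 0 ^ 2 * X 1) + C (x 2) * (X 0 * X 1 ^ 2) +
      C (x 3) * X 1 ^ 3, by
    have h0 := isHomogeneous_X F (0 : Fin 2)
    have h1 := isHomogeneous_X F (1 : Fin 2)
    exact ((((h0.pow 3).C_mul _).add (((h0.pow 2).mul h1).C_mul _)).add
      ((h0.mul (h1.pow 2)).C_mul _)).add ((h1.pow 3).C_mul _)⟩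
  map_add' x y := by
    ext1
    simp only [Pi.add_apply, C_add, Submodule.coe_add]
    ring
  map_smul' c x := by
    ext1
    simp only [Pi.smul_apply, smul_eq_mul, C_mul, Submodule.coe_smul, RingHom.id_apply,
      smul_eq_C_mul]
    ring

open MvPolynomial in
theorem coe_cubicForm {F : Type*} [Field F] (x : Fin 4 → F) :
    (cubicForm F x : MvPolynomial (Fin 2) F) =
      C (x 0) * X 0 ^ 3 + C (x 1) * (X 0 ^ 2 * X 1) + C (x 2) * (X 0 * X 1 ^ 2) +
        C (x 3) * X 1 ^ 3 := rfl

/-- The exponent vector `(i, j)` of a monomial in two variables. -/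
noncomputable def binaryExponent (i j : ℕ) : Fin 2 →₀ ℕ :=
  Finsupp.single 0 i + Finsupp.single 1 j

theorem binaryExponent_inj {i j k l : ℕ} :
    binaryExponent i j = binaryExponent k l ↔ i = k ∧ j = l := by
  simp [binaryExponent, Finsupp.ext_iff, Fin.forall_fin_two]

open MvPolynomial in
theorem coe_cubicForm_eq_monomial {F : Type*} [Field F] (x : Fin 4 → F) :
    (cubicForm F x : MvPolynomial (Fin 2) F) =
      monomial (binaryExponent 3 0) (x 0) + monomial (binaryExponent 2 1) (x 1) +
        monomial (binaryExponent 1 2) (x 2) + monomial (binaryExponent 0 3) (x 3) := by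
  have key (i j : ℕ) (c : F) :
      monomial (binaryExponent i j) c = C c * (X 0 ^ i * X 1 ^ j) := by
    rw [X_pow_eq_monomial, X_pow_eq_monomial, monomial_mul, C_mul_monomial, binaryExponent]
    simp
  simp [coe_cubicForm, key]

open MvPolynomial in
theorem cubicForm_bijective (F : Type*) [Field F] : Function.Bijective (cubicForm F) := by
  constructor
  · intro x y hxy
    have h (d : Fin 2 →₀ ℕ) := congrArg (fun f => coeff d f.1) hxy
    simp only [coe_cubicForm_eq_monomial, coeff_add, coeff_monomial] at h
    ext i
    fin_cases i
    · simpa [binaryExponent_inj] using h (binaryExponent 3 0)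
    · simpa [binaryExponent_inj] using h (binaryExponent 2 1)
    · simpa [binaryExponent_inj] using h (binaryExponent 1 2)
    · simpa [binaryExponent_inj] using h (binaryExponent 0 3)
  · rintro ⟨f, hf⟩
    refine ⟨![coeff (binaryExponent 3 0) f, coeff (binaryExponent 2 1) f,
      coeff (binaryExponent 1 2) f, coeff (binaryExponent 0 3) f], ?_⟩
    ext d
    rw [coe_cubicForm_eq_monomial]
    have hd : d = binaryExponent (d 0) (d 1) := by
      ext i
      fin_cases i <;> simp [binaryExponent]
    simp only [coeff_add, coeff_monomial]
    by_cases hsum : d 0 + d 1 = 3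
    · have : d 0 = 0 ∨ d 0 = 1 ∨ d 0 = 2 ∨ d 0 = 3 := by omega
      rcases this with h | h | h | h
      · have h' : d 1 = 3 := by omega
        rw [hd, h, h']; simp [binaryExponent_inj]
      · have h' : d 1 = 2 := by omega
        rw [hd, h, h']; simp [binaryExponent_inj]
      · have h' : d 1 = 1 := by omega
        rw [hd, h, h']; simp [binaryExponent_inj]
      · have h' : d 1 = 0 := by omega
        rw [hd, h, h']; simp [binaryExponent_inj]
    · have hz : coeff d f = 0 := by
        rw [mem_homogeneousSubmodule] at hf
        refine hf.coeff_eq_zero ?_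
        rwa [Finsupp.degree_eq_sum, Fin.sum_univ_two]
      rw [hz, hd]
      simp only [binaryExponent_inj]
      rw [if_neg (by omega), if_neg (by omega), if_neg (by omega), if_neg (by omega)]
      simp

/-- The coordinates of a binary cubic form in the monomials `X³, X²Y, XY², Y³`. -/
noncomputable def cubicFormEquiv (F : Type*) [Field F] :
    (Fin 4 → F) ≃ₗ[F] MvPolynomial.homogeneousSubmodule (Fin 2) F 3 :=
  LinearEquiv.ofBijective (cubicForm F) (cubicForm_bijective F)

/-- The symmetric cube of a `2 × 2` matrix: the matrix of substitution on binary cubic forms in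
the monomials `X³, X²Y, XY², Y³`. -/
def symCube {F : Type*} [Field F] (m : Matrix (Fin 2) (Fin 2) F) : Matrix (Fin 4) (Fin 4) F :=
  let a := m 0 0
  let b := m 0 1
  let c := m 1 0
  let d := m 1 1
  !![a ^ 3, a ^ 2 * c, a * c ^ 2, c ^ 3;
    3 * a ^ 2 * b, a ^ 2 * d + 2 * a * b * c, 2 * a * c * d + b * c ^ 2, 3 * c ^ 2 * d;
    3 * a * b ^ 2, 2 * a * b * d + b ^ 2 * c, a * d ^ 2 + 2 * b * c * d, 3 * c * d ^ 2;
    b ^ 3, b ^ 2 * d, b * d ^ 2, d ^ 3]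

theorem trace_symCube {F : Type*} [Field F] (m : Matrix (Fin 2) (Fin 2) F) :
    (symCube m).trace = m.trace ^ 3 - 2 * m.trace * m.det := by
  simp [symCube, Matrix.trace, Fin.sum_univ_succ, Matrix.det_fin_two]
  ring

theorem det_symCube_sub_one {F : Type*} [Field F] (m : Matrix (Fin 2) (Fin 2) F) :
    (symCube m - 1).det = (1 - m.det * m.trace + m.det ^ 3) *
      (1 - (m.trace ^ 3 - 3 * m.trace * m.det) + m.det ^ 3) := by
  simp [symCube, Matrix.trace, Matrix.det_succ_row_zero, Fin.sum_univ_succ, Matrix.one_apply,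
    Fin.succAbove]
  ring

open MvPolynomial in
theorem cubicAction_cubicForm {F : Type*} [Field F] (g : Matrix.SpecialLinearGroup (Fin 2) F)
    (x : Fin 4 → F) :
    cubicAction F g (cubicForm F x) =
      cubicForm F ((symCube (g⁻¹ : Matrix.SpecialLinearGroup (Fin 2) F).1).mulVec x) := by
  ext1
  change substMap F _ (cubicForm F x).1 = (cubicForm F _).1
  generalize (g⁻¹ : Matrix.SpecialLinearGroup (Fin 2) F).1 = m
  simp [substMap, coe_cubicForm, symCube, dotProduct, Fin.sum_univ_succ,
    smul_eq_C_mul, algebraMap_eq]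
  have h2 : (C 2 : MvPolynomial (Fin 2) F) = 2 := map_ofNat C 2
  have h3 : (C 3 : MvPolynomial (Fin 2) F) = 3 := map_ofNat C 3
  rw [h2, h3]
  ring

theorem cubicAction_eq_conj {F : Type*} [Field F] (g : Matrix.SpecialLinearGroup (Fin 2) F) :
    cubicAction F g = (cubicFormEquiv F).conj
      (Matrix.toLin' (symCube (g⁻¹ : Matrix.SpecialLinearGroup (Fin 2) F).1)) := by
  refine LinearMap.ext fun f => ?_
  obtain ⟨x, rfl⟩ := (cubicFormEquiv F).surjective f
  rw [LinearEquiv.conj_apply_apply, LinearEquiv.symm_apply_apply, Matrix.toLin'_apply]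
  exact cubicAction_cubicForm g x

theorem coe_cubicAction {F : Type*} [Field F] (g : Matrix.SpecialLinearGroup (Fin 2) F)
    (f : MvPolynomial.homogeneousSubmodule (Fin 2) F 3) :
    (cubicAction F g f : MvPolynomial (Fin 2) F) =
      substMap F (g⁻¹ : Matrix.SpecialLinearGroup (Fin 2) F).1 f := rfl

theorem substMap_one (F : Type*) [Field F] : substMap F 1 = AlgHom.id F _ := by
  refine MvPolynomial.algHom_ext fun i => ?_
  fin_cases i <;> simp [substMap]

theorem substMap_mul {F : Type*} [Field F] (m n : Matrix (Fin 2) (Fin 2) F) :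
    substMap F (m * n) = (substMap F n).comp (substMap F m) := by
  refine MvPolynomial.algHom_ext fun i => ?_
  simp [substMap, Matrix.mul_apply, Fin.sum_univ_two, add_smul, mul_smul, smul_add]
  abel

theorem cubicAction_one (F : Type*) [Field F] : cubicAction F 1 = 1 := by
  refine LinearMap.ext fun f => Subtype.ext ?_
  rw [coe_cubicAction, inv_one, Matrix.SpecialLinearGroup.coe_one, substMap_one]
  rfl

theorem cubicAction_mul {F : Type*} [Field F] (g h : Matrix.SpecialLinearGroup (Fin 2) F) :
    cubicAction F (g * h) = cubicAction F g * cubicAction F h := by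
  refine LinearMap.ext fun f => Subtype.ext ?_
  rw [Module.End.mul_apply, coe_cubicAction, coe_cubicAction, coe_cubicAction, mul_inv_rev,
    Matrix.SpecialLinearGroup.coe_mul, substMap_mul, AlgHom.comp_apply]

/-- `cubicAction` as a representation of `SL₂`. -/
noncomputable def cubicActionHom (F : Type*) [Field F] :
    Matrix.SpecialLinearGroup (Fin 2) F →*
      Module.End F (MvPolynomial.homogeneousSubmodule (Fin 2) F 3) where
  toFun := cubicAction F
  map_one' := cubicAction_one F
  map_mul' := cubicAction_mul

theorem cubicAction_pow {F : Type*} [Field F] (g : Matrix.SpecialLinearGroup (Fin 2) F) (n : ℕ) :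
    cubicAction F (g ^ n) = cubicAction F g ^ n :=
  map_pow (cubicActionHom F) g n

theorem trace_inv_specialLinearGroup_two {F : Type*} [Field F]
    (g : Matrix.SpecialLinearGroup (Fin 2) F) :
    (g⁻¹ : Matrix.SpecialLinearGroup (Fin 2) F).1.trace = g.1.trace := by
  simp [Matrix.SpecialLinearGroup.coe_inv, Matrix.adjugate_fin_two, Matrix.trace_fin_two, add_comm]

theorem trace_cubicAction {F : Type*} [Field F] (g : Matrix.SpecialLinearGroup (Fin 2) F) :
    LinearMap.trace F _ (cubicAction F g) = g.1.trace ^ 3 - 2 * g.1.trace := by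
  rw [cubicAction_eq_conj, LinearMap.trace_conj', Matrix.trace_toLin'_eq, trace_symCube,
    trace_inv_specialLinearGroup_two, (g⁻¹).2, mul_one]

theorem sq_eq_trace_smul_sub_one {F : Type*} [Field F]
    (g : Matrix.SpecialLinearGroup (Fin 2) F) : g.1 ^ 2 = g.1.trace • g.1 - 1 := by
  have hdet := g.2
  rw [Matrix.det_fin_two] at hdet
  ext i j
  fin_cases i <;> fin_cases j <;>
    simp [pow_two, Matrix.mul_apply, Fin.sum_univ_two, Matrix.trace_fin_two] <;>
    grind

theorem trace_eq_of_cubicAction_fixed {F : Type*} [Field F]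
    (g : Matrix.SpecialLinearGroup (Fin 2) F)
    {f : MvPolynomial.homogeneousSubmodule (Fin 2) F 3} (hf : f ≠ 0)
    (hfix : cubicAction F g f = f) : g.1.trace = 2 ∨ g.1.trace = -1 := by
  obtain ⟨x, rfl⟩ := (cubicFormEquiv F).surjective f
  have hx : x ≠ 0 := by
    rintro rfl
    simp at hf
  rw [cubicAction_eq_conj, LinearEquiv.conj_apply_apply, LinearEquiv.symm_apply_apply,
    Matrix.toLin'_apply] at hfix
  have hdet : (symCube (g⁻¹ : Matrix.SpecialLinearGroup (Fin 2) F).1 - 1).det = 0 := by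
    refine Matrix.exists_mulVec_eq_zero_iff.1 ⟨x, hx, ?_⟩
    rw [Matrix.sub_mulVec, Matrix.one_mulVec, (cubicFormEquiv F).injective hfix, sub_self]
  rw [det_symCube_sub_one, trace_inv_specialLinearGroup_two, (g⁻¹).2] at hdet
  have : (g.1.trace - 2) ^ 2 * (g.1.trace + 1) ^ 2 = 0 := by
    linear_combination hdet
  rcases mul_eq_zero.1 this with h | h
  · exact Or.inl (sub_eq_zero.1 (pow_eq_zero_iff two_ne_zero |>.1 h))
  · exact Or.inr (eq_neg_of_add_eq_zero_left (pow_eq_zero_iff two_ne_zero |>.1 h))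

theorem pow_three_eq_one_of_trace_eq_neg_one {F : Type*} [Field F]
    {g : Matrix.SpecialLinearGroup (Fin 2) F} (ht : g.1.trace = -1) : g ^ 3 = 1 := by
  have h := sq_eq_trace_smul_sub_one g
  rw [ht] at h
  apply Subtype.ext
  change g.1 ^ 3 = 1
  rw [pow_succ, h, sub_mul, one_mul, neg_one_smul, neg_mul, ← pow_two, h, neg_one_smul]
  abel

theorem pow_char_eq_one_of_trace_eq_two {F : Type*} [Field F] (p : ℕ) [Fact p.Prime] [CharP F p]
    {g : Matrix.SpecialLinearGroup (Fin 2) F} (ht : g.1.trace = 2) : g ^ p = 1 := by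
  have h := sq_eq_trace_smul_sub_one g
  have hsq : (g.1 - 1) ^ 2 = 0 := by
    rw [ht, two_smul] at h
    rw [pow_two, sub_mul, mul_sub, ← pow_two, h, mul_one, one_mul]
    abel
  have hp : (g.1 - 1) ^ p = 0 := pow_eq_zero_of_le (Fact.out : p.Prime).two_le hsq
  rw [sub_pow_char_of_commute (p := p) (Commute.one_right _), one_pow, sub_eq_zero] at hp
  exact Subtype.ext hp

theorem trace_eq_neg_one_of_orderOf_eq_three {F : Type*} [Field F]
    {g : Matrix.SpecialLinearGroup (Fin 2) F} (hg : orderOf g = 3) : g.1.trace = -1 := by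
  by_contra ht
  have h3 : g.1 ^ 3 = 1 := by
    rw [← Matrix.SpecialLinearGroup.coe_pow, orderOf_dvd_iff_pow_eq_one.1 hg.dvd,
      Matrix.SpecialLinearGroup.coe_one]
  have h2 := sq_eq_trace_smul_sub_one g
  set t := g.1.trace
  have ht' : t + 1 ≠ 0 := fun h => ht (eq_neg_of_add_eq_zero_left h)
  have hlin : (t - 1) • g.1 = 1 := by
    rw [pow_succ, h2, sub_mul, one_mul, smul_mul_assoc, ← pow_two, h2] at h3
    refine smul_right_injective _ ht' ?_
    change (t + 1) • (t - 1) • g.1 = (t + 1) • (1 : Matrix (Fin 2) (Fin 2) F)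
    linear_combination (norm := module) h3
  have hs2 : (t - 1) ^ 2 = 1 := by
    have := congrArg Matrix.det hlin
    rwa [Matrix.det_smul, g.2, Matrix.det_one, mul_one, Fintype.card_fin] at this
  have hs3 : (t - 1) ^ 3 = 1 := by
    have := congrArg (· ^ 3) hlin
    simp only [smul_pow, h3, one_pow] at this
    simpa using congrFun (congrFun this 0) 0
  have hs : t - 1 = 1 := by linear_combination hs3 - (t - 1) * hs2
  rw [hs, one_smul] at hlin
  rw [show g = 1 from Subtype.ext hlin, orderOf_one] at hg
  omega

/-- If `x² + x + 1` has no root in the field and `(1 + T + T²) / 3` projects onto the fixed space of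
`T`, which has codimension `2`, then `T` is a `2`-stingray element. -/
theorem isStingrayOn_two_of_isProj {F : Type*} [Field F] {M : Type*} [AddCommGroup M]
    [Module F M] [FiniteDimensional F M] {T : Module.End F M} (h3 : (3 : F) ≠ 0)
    (hroot : ∀ c : F, c ^ 2 + c + 1 ≠ 0)
    (hdim : Module.finrank F (LinearMap.ker (T - LinearMap.id)) + 2 = Module.finrank F M)
    (π : Module.End F M) (hπ : (3 : F) • π = 1 + T + T ^ 2)
    (hproj : LinearMap.IsProj (LinearMap.ker (T - LinearMap.id)) π) :
    IsStingrayOn F T 2 := by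
  have hmem (u : M) : u ∈ LinearMap.ker π ↔ u + T u + T (T u) = 0 := by
    have := LinearMap.congr_fun hπ u
    simp only [LinearMap.smul_apply, LinearMap.add_apply, Module.End.one_apply, pow_two,
      Module.End.mul_apply] at this
    rw [LinearMap.mem_ker, ← this, smul_eq_zero_iff_right h3]
  have hcompl := hproj.isCompl.symm
  have hrank : Module.finrank F (LinearMap.ker π) = 2 := by
    have := Submodule.finrank_add_eq_of_isCompl hcompl
    omega
  refine ⟨LinearMap.ker π, hrank, ?_, hcompl, fun W hW hTW => ?_⟩
  · rintro _ ⟨u, hu, rfl⟩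
    have := congrArg T ((hmem u).1 hu)
    rw [hmem]
    simpa using this
  · by_contra! hne
    have hlt := Submodule.finrank_lt_finrank_of_lt (lt_of_le_of_ne hW hne.2)
    have hpos : Module.finrank F W ≠ 0 := fun h => hne.1 (Submodule.finrank_eq_zero.1 h)
    obtain ⟨⟨w, hw⟩, hw0, hspan⟩ := finrank_eq_one_iff'.1
      (show Module.finrank F W = 1 by omega)
    obtain ⟨c, hc⟩ := hspan ⟨T w, hTW ⟨w, hw, rfl⟩⟩
    replace hc : c • w = T w := congrArg Subtype.val hc
    have := (hmem w).1 (hW hw)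
    rw [← hc, map_smul, ← hc] at this
    have hsm : (c ^ 2 + c + 1) • w = 0 := by
      rw [← this]
      module
    rcases smul_eq_zero.1 hsm with h | h
    · exact hroot c h
    · exact hw0 (Subtype.ext h)

theorem isProj_average_of_pow_three {F : Type*} [Field F] {M : Type*} [AddCommGroup M]
    [Module F M] {T : Module.End F M} (h3 : (3 : F) ≠ 0) (hT : T ^ 3 = 1) :
    LinearMap.IsProj (LinearMap.ker (T - LinearMap.id)) ((3 : F)⁻¹ • (1 + T + T ^ 2)) := by
  constructor
  · intro u
    have hu : T (T (T u)) = u := by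
      simpa [pow_succ] using LinearMap.congr_fun hT u
    simp only [LinearMap.mem_ker, LinearMap.sub_apply, LinearMap.id_apply, LinearMap.smul_apply,
      LinearMap.add_apply, Module.End.one_apply, pow_two, Module.End.mul_apply, map_smul, map_add,
      hu]
    module
  · intro u hu
    have hu' : T u = u := by simpa [sub_eq_zero] using hu
    simp only [LinearMap.smul_apply, LinearMap.add_apply, Module.End.one_apply, pow_two,
      Module.End.mul_apply, hu']
    rw [inv_smul_eq_iff₀ h3]
    module

theorem trace_of_pow_three {F : Type*} [Field F] {M : Type*} [AddCommGroup M]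
    [Module F M] [FiniteDimensional F M] {T : Module.End F M} (h3 : (3 : F) ≠ 0) (hT : T ^ 3 = 1) :
    (Module.finrank F M : F) + LinearMap.trace F M T + LinearMap.trace F M (T ^ 2) =
      3 * Module.finrank F (LinearMap.ker (T - LinearMap.id)) := by
  have htr := (isProj_average_of_pow_three h3 hT).trace
  rwa [map_smul, map_add, map_add, LinearMap.trace_one, smul_eq_mul,
    inv_mul_eq_iff_eq_mul₀ h3] at htr

theorem FiniteField.sq_add_self_add_one_ne_zero {F : Type*} [Field F] [Fintype F]
    (h3 : (3 : F) ≠ 0) (hq : Fintype.card F % 3 = 2) (c : F) : c ^ 2 + c + 1 ≠ 0 := by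
  intro h
  have hc3 : c ^ 3 = 1 := by linear_combination (c - 1) * h
  have hc := FiniteField.pow_card c
  rw [← Nat.div_add_mod (Fintype.card F) 3, hq, pow_add, pow_mul, hc3, one_pow, one_mul] at hc
  have hc1 : c = 1 := by
    have : c ^ 2 * c = c * c := by rw [hc]
    linear_combination hc3 - this - hc
  rw [hc1] at h
  exact h3 (by linear_combination h)

theorem isStingrayOn_cubicAction_of_orderOf_eq_three {F : Type*} [Field F] [Fintype F] (p : ℕ)
    [CharP F p] (hp5 : 5 ≤ p) (hq : Fintype.card F % 3 = 2)
    {h : Matrix.SpecialLinearGroup (Fin 2) F} (hh : orderOf h = 3) :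
    IsStingrayOn F (cubicAction F h) 2 := by
  have h3 : (3 : F) ≠ 0 := by
    intro h0
    have := Nat.le_of_dvd (by norm_num) ((CharP.cast_eq_zero_iff F p 3).1 (by exact_mod_cast h0))
    omega
  have hT : cubicAction F h ^ 3 = 1 := by
    rw [← cubicAction_pow, orderOf_dvd_iff_pow_eq_one.1 hh.dvd, cubicAction_one]
  have ht := trace_eq_neg_one_of_orderOf_eq_three hh
  have hh2 : orderOf (h ^ 2) = 3 := by
    rw [Nat.Coprime.orderOf_pow (by rw [hh]; norm_num), hh]
  have ht2 := trace_eq_neg_one_of_orderOf_eq_three hh2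
  have hM : Module.finrank F (MvPolynomial.homogeneousSubmodule (Fin 2) F 3) = 4 := by
    rw [← (cubicFormEquiv F).finrank_eq, Module.finrank_fin_fun]
  have : FiniteDimensional F (MvPolynomial.homogeneousSubmodule (Fin 2) F 3) :=
    (cubicFormEquiv F).finiteDimensional
  have hproj := isProj_average_of_pow_three h3 hT
  refine isStingrayOn_two_of_isProj h3 (FiniteField.sq_add_self_add_one_ne_zero h3 hq)
    ?_ _ (smul_inv_smul₀ h3 _) hproj
  have htr := trace_of_pow_three h3 hT
  rw [← cubicAction_pow, trace_cubicAction, trace_cubicAction, ht, ht2, hM] at htr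
  set n := Module.finrank F (LinearMap.ker (cubicAction F h - LinearMap.id))
  have hn4 : n ≤ 4 := hM ▸ Submodule.finrank_le _
  have hn : (n : F) = (2 : ℕ) := by
    apply mul_left_cancel₀ h3
    rw [← htr]
    norm_num
  have hmod := (CharP.natCast_eq_natCast F p).1 hn
  have := hmod.eq_of_lt_of_lt (by omega) (by omega)
  omega

theorem eq_three_of_orderOf_cubicAction {F : Type*} [Field F] (p : ℕ) [Fact p.Prime] [CharP F p]
    {h : Matrix.SpecialLinearGroup (Fin 2) F} {r : ℕ} (hr : r.Prime) (hrp : r ≠ p)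
    (hord : orderOf (cubicAction F h) = r) (hst : IsStingrayOn F (cubicAction F h) 2) : r = 3 := by
  obtain ⟨U, hU, -, hcompl, -⟩ := hst
  have : FiniteDimensional F (MvPolynomial.homogeneousSubmodule (Fin 2) F 3) :=
    (cubicFormEquiv F).finiteDimensional
  have hrank := Submodule.finrank_add_eq_of_isCompl hcompl
  rw [hU, ← (cubicFormEquiv F).finrank_eq, Module.finrank_fin_fun] at hrank
  obtain ⟨f, hf, hf0⟩ := Submodule.exists_mem_ne_zero_of_ne_bot
    (p := LinearMap.ker (cubicAction F h - LinearMap.id)) (by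
      intro hbot
      rw [hbot, finrank_bot] at hrank
      omega)
  have hfix : cubicAction F h f = f := by simpa [sub_eq_zero] using hf
  have hdvd {n : ℕ} (hn : h ^ n = 1) : r ∣ n := by
    rw [← hord]
    exact orderOf_dvd_of_pow_eq_one (by rw [← cubicAction_pow, hn, cubicAction_one])
  rcases trace_eq_of_cubicAction_fixed h hf0 hfix with ht | ht
  · exact absurd ((Nat.prime_dvd_prime_iff_eq hr Fact.out).1
      (hdvd (pow_char_eq_one_of_trace_eq_two p ht))) hrp
  · exact (Nat.prime_dvd_prime_iff_eq hr Nat.prime_three).1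
      (hdvd (pow_three_eq_one_of_trace_eq_neg_one ht))

/-- Let `q = p^a` with `p ≥ 5` prime and `q ≥ 7`, and let `SL₂(𝔽_q)` act on the
`4`-dimensional space of homogeneous cubic polynomials in two variables by
`(g · f)(v) = f (g⁻¹ v)`.
(a) If `q ≡ 2 (mod 3)`, then every `h ∈ SL₂(𝔽_q)` of order `3` induces a `2`-stingray
element (and `3` is then a primitive prime divisor of `q² - 1`).
(b) Conversely, if some `h ∈ SL₂(𝔽_q)` induces a `2`-stingray element of prime order
`r`, with `r` a primitive prime divisor of `q² - 1`, then `q ≡ 2 (mod 3)` and `r = 3`. -/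
theorem stmt16 (p a q : ℕ) (hp : p.Prime) (hp5 : 5 ≤ p) (ha : 0 < a)
    (hq : q = p ^ a) (hq7 : 7 ≤ q)
    (F : Type*) [Field F] [Fintype F] (hF : Fintype.card F = q) :
    (q % 3 = 2 →
      (∀ h : Matrix.SpecialLinearGroup (Fin 2) F, orderOf h = 3 →
        IsStingrayOn F (cubicAction F h) 2) ∧
      (Nat.Prime 3 ∧ 3 ∣ q ^ 2 - 1 ∧ ¬ (3 : ℕ) ∣ q - 1)) ∧
    (∀ h : Matrix.SpecialLinearGroup (Fin 2) F, ∀ r : ℕ, r.Prime →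
      r ∣ q ^ 2 - 1 → ¬ r ∣ q - 1 →
      orderOf (cubicAction F h) = r → IsStingrayOn F (cubicAction F h) 2 →
      q % 3 = 2 ∧ r = 3) := by
  have : Fact p.Prime := ⟨hp⟩
  have : CharP F p := charP_of_card_eq_prime_pow (f := a) (by rw [hF, hq])
  have hfac : q ^ 2 - 1 = (q + 1) * (q - 1) := by simpa using Nat.sq_sub_sq q 1
  refine ⟨fun hmod => ⟨fun h hh => ?_, Nat.prime_three, ?_, by omega⟩,
    fun h r hr hdvd hndvd hord hst => ?_⟩
  · exact isStingrayOn_cubicAction_of_orderOf_eq_three p hp5 (hF ▸ hmod) hh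
  · rw [hfac]
    exact Dvd.dvd.mul_right (by omega) _
  · rw [hfac] at hdvd
    have hdvd' := (hr.dvd_mul.1 hdvd).resolve_right hndvd
    have hrp : r ≠ p := by
      rintro rfl
      have h1 : r ∣ q := hq ▸ dvd_pow_self r ha.ne'
      exact hr.one_lt.ne' (Nat.dvd_one.1 ((Nat.dvd_add_right h1).1 hdvd'))
    obtain rfl := eq_three_of_orderOf_cubicAction p hr hrp hord hst
    omega
end
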